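/- arXiv:math/0012258 — 10 statements merged into one kernel-verified Lean document; each statement's English description precedes it below -/
import Mathlib

section
/- For a finite simple graph G on a finite vertex set V and any spanning subgraph U ≤ G, one has |A(U)| · s(U;G) = |A(G)| · x(U;G), where A(U) and A(G) are the automorphism groups of U and G, s(U;G) is the number of spanning subgraphs of G isomorphic to U, and x(U;G) is the number of graphs X on V with U ≤ X and X isomorphic to G. -/
/-- `σ` is an automorphism of the simple graph `G`. -/
def IsAut {V : Type*} (G : SimpleGraph V) (σ : Equiv.Perm V) : Prop :=
  ∀ u v, G.Adj (σ u) (σ v) ↔ G.Adj u v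

/-- `|A(G)|`, the number of automorphisms of `G`. -/
noncomputable def autCard {V : Type*} (G : SimpleGraph V) : ℕ :=
  Nat.card {σ : Equiv.Perm V // IsAut G σ}

/-- `|A(U) ∩ A(G)|`, the number of common automorphisms of `U` and `G`. -/
noncomputable def autCapCard {V : Type*} (U G : SimpleGraph V) : ℕ :=
  Nat.card {σ : Equiv.Perm V // IsAut U σ ∧ IsAut G σ}

/-- `s(U;G)`: the number of spanning subgraphs of `G` isomorphic to `U`. -/
noncomputable def sCard {V : Type*} (U G : SimpleGraph V) : ℕ :=
  Nat.card {U' : SimpleGraph V // U' ≤ G ∧ Nonempty (U' ≃g U)}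

/-- `x(U;G)`: the number of graphs `X` on `V` with `U ≤ X` and `X` isomorphic to `G`. -/
noncomputable def xCard {V : Type*} (U G : SimpleGraph V) : ℕ :=
  Nat.card {X : SimpleGraph V // U ≤ X ∧ Nonempty (X ≃g G)}

/-- `s₀(U;G)`: the number of spanning subgraphs of `G` that are `G`-similar to `U`,
i.e. images of `U` under an automorphism of `G`. -/
noncomputable def s0Card {V : Type*} (U G : SimpleGraph V) : ℕ :=
  Nat.card {U' : SimpleGraph V //
    U' ≤ G ∧ ∃ σ : Equiv.Perm V, IsAut G σ ∧ U.map σ.toEmbedding = U'}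

/-- `U` is a fixing subgraph of `G`: it is a spanning subgraph and
`s(U;G) = |A(G)| / |A(U) ∩ A(G)|`. -/
noncomputable def IsFixing {V : Type*} (U G : SimpleGraph V) : Prop :=
  U ≤ G ∧ sCard U G = autCard G / autCapCard U G

/-- `U` is a strong fixing subgraph of `G`: a fixing subgraph all of whose
automorphisms are automorphisms of `G`. -/
noncomputable def IsStrongFixing {V : Type*} (U G : SimpleGraph V) : Prop :=
  IsFixing U G ∧ ∀ σ : Equiv.Perm V, IsAut U σ → IsAut G σ

/-- `C` is a hamiltonian cycle of `G`: a connected 2-regular spanning subgraph. -/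
def IsHamCycle {V : Type*} (G C : SimpleGraph V) : Prop :=
  C ≤ G ∧ C.Connected ∧ ∀ v, Nat.card {w // C.Adj v w} = 2

/-- `G ∈ F(HAM)`: `G` is hamiltonian and every hamiltonian cycle of `G` is a
fixing subgraph of `G`. -/
noncomputable def InFHAM {V : Type*} (G : SimpleGraph V) : Prop :=
  (∃ C, IsHamCycle G C) ∧ ∀ C, IsHamCycle G C → IsFixing C G

/-- `G ∈ F*(HAM)`: `G` is hamiltonian and every hamiltonian cycle of `G` is a
strong fixing subgraph of `G`. -/
noncomputable def InFstarHAM {V : Type*} (G : SimpleGraph V) : Prop :=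
  (∃ C, IsHamCycle G C) ∧ ∀ C, IsHamCycle G C → IsStrongFixing C G

/-- The generalized Petersen graph `G(n,k)`, with outer vertices `Sum.inl i = aᵢ`
and inner vertices `Sum.inr i = bᵢ`, edges `aᵢaᵢ₊₁`, `aᵢbᵢ`, `bᵢbᵢ₊ₖ`. -/
def genPetersen (n k : ℕ) : SimpleGraph (ZMod n ⊕ ZMod n) :=
  SimpleGraph.fromRel fun v w =>
    match v, w with
    | Sum.inl i, Sum.inl j => j = i + 1
    | Sum.inl i, Sum.inr j => j = i
    | Sum.inr i, Sum.inr j => j = i + (k : ZMod n)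
    | _, _ => False

/-- The Heawood graph on `ZMod 14`: `i ~ i+1` for all `i`, and `i ~ i+5` for even `i`
(LCF notation `[5,-5]⁷`). -/
def heawood : SimpleGraph (ZMod 14) :=
  SimpleGraph.fromRel fun i j => j = i + 1 ∨ (Even i.val ∧ j = i + 5)

/-- The spanning cycle of the Heawood graph through `0, 1, …, 13` in order. -/
def heawoodCycle : SimpleGraph (ZMod 14) :=
  SimpleGraph.fromRel fun i j => j = i + 1

theorem comap_comp_aux {V : Type*} (H X : SimpleGraph V) (f : X ≃g H)
    (b : Equiv.Perm V) (hb : IsAut H b) :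
    H.comap ((f.toEquiv.trans b : Equiv.Perm V) : V → V) = X := by
  ext u v
  simp only [SimpleGraph.comap_adj, Equiv.trans_apply]
  rw [hb]
  exact f.map_rel_iff

theorem card_comap_aux {V : Type*} (H : SimpleGraph V) (P : SimpleGraph V → Prop) :
    Nat.card {σ : Equiv.Perm V // P (H.comap (σ : V → V))} =
      autCard H * Nat.card {X : SimpleGraph V // P X ∧ Nonempty (X ≃g H)} := by
  classical
  unfold autCard
  rw [← Nat.card_prod]
  symm
  refine Nat.card_congr (Equiv.ofBijective
    (fun p => ⟨(p.2.2.2.some.toEquiv.trans p.1.1 : Equiv.Perm V), by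
      rw [comap_comp_aux H p.2.1 _ _ p.1.2]; exact p.2.2.1⟩) ⟨?_, ?_⟩)
  · rintro ⟨⟨b, hb⟩, ⟨X, hX⟩⟩ ⟨⟨c, hc⟩, ⟨Y, hY⟩⟩ h
    have h1 := congrArg Subtype.val h
    dsimp only at h1
    have hXY : X = Y := by
      rw [← comap_comp_aux H X hX.2.some b hb, h1, comap_comp_aux H Y hY.2.some c hc]
    subst hXY
    have : b = c := by
      ext v
      have h2 := Equiv.congr_fun h1 (hX.2.some.toEquiv.symm v)
      simpa only [Equiv.trans_apply, Equiv.apply_symm_apply] using h2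
    subst this
    rfl
  · rintro ⟨σ, hσ⟩
    have hX : Nonempty (H.comap (σ : V → V) ≃g H) := ⟨⟨σ, Iff.rfl⟩⟩
    refine ⟨⟨⟨hX.some.toEquiv.symm.trans σ, ?_⟩, ⟨H.comap (σ : V → V), hσ, hX⟩⟩, ?_⟩
    · intro u v
      have := hX.some.symm.map_rel_iff (a := u) (b := v)
      exact this
    · apply Subtype.ext
      ext v
      exact congrArg σ (hX.some.toEquiv.symm_apply_apply v)

/-- **Theorem 1.** `|A(U)| · s(U;G) = |A(G)| · x(U;G)` for a spanning subgraph `U ≤ G`. -/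
theorem autCard_mul_sCard_eq {V : Type*} [Fintype V] (U G : SimpleGraph V) (hUG : U ≤ G) :
    autCard U * sCard U G = autCard G * xCard U G := by
  classical
  have h1 := card_comap_aux U (fun X => X ≤ G)
  have h2 := card_comap_aux G (fun X => U ≤ X)
  unfold sCard xCard
  rw [← h1, ← h2]
  refine Nat.card_congr ((Equiv.inv (Equiv.Perm V)).subtypeEquiv ?_)
  intro σ
  constructor
  · intro h u v huv
    apply h
    simpa using huv
  · intro h u v huv
    have := h huv
    simpa using this
end

section
/- Let G be a finite simple graph on a finite vertex set V and let U ≤ G be a spanning subgraph. Then U is a strong fixing subgraph of G if and only if for every spanning subgraph U₀ ≤ G with U₀ isomorphic to U, every isomorphism σ : U₀ → U (i.e., every permutation σ of V with σ(U₀) = U) is an automorphism of G. -/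
theorem card_key {V : Type*} (U G : SimpleGraph V) :
    Nat.card {σ : Equiv.Perm V // ∀ u v, U.Adj (σ u) (σ v) → G.Adj u v}
      = sCard U G * autCard U := by
  unfold sCard autCard
  rw [← Nat.card_prod]
  symm
  let e : ∀ X : {U' : SimpleGraph V // U' ≤ G ∧ Nonempty (U' ≃g U)}, X.1 ≃g U :=
    fun X => Classical.choice X.2.2
  have he : ∀ X u v, U.Adj (e X u) (e X v) ↔ X.1.Adj u v := fun X u v => (e X).map_rel_iff
  refine Nat.card_congr (Equiv.ofBijective
    (fun p => ⟨(e p.1).toEquiv.trans p.2.1, ?_⟩) ⟨?_, ?_⟩)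
  · intro u v h
    exact p.1.2.1 ((he p.1 u v).1 ((p.2.2 _ _).1 h))
  · rintro ⟨X, a, ha⟩ ⟨Y, b, hb⟩ h
    have h1 : ∀ u, a (e X u) = b (e Y u) := fun u =>
      Equiv.congr_fun (congrArg Subtype.val h) u
    have hXY : X = Y := by
      apply Subtype.ext
      ext u v
      rw [← he X, ← he Y, ← ha (e X u) (e X v), ← hb (e Y u) (e Y v), h1, h1]
    subst hXY
    have hab : a = b := by
      ext u
      have := h1 ((e X).symm u)
      simpa using this
    subst hab
    rfl
  · rintro ⟨σ, hσ⟩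
    let X : {U' : SimpleGraph V // U' ≤ G ∧ Nonempty (U' ≃g U)} :=
      ⟨U.comap σ, fun u v h => hσ u v h, ⟨⟨σ, Iff.rfl⟩⟩⟩
    refine ⟨⟨X, (e X).toEquiv.symm.trans σ, ?_⟩, ?_⟩
    · intro u v
      have := he X ((e X).symm u) ((e X).symm v)
      simp only [RelIso.apply_symm_apply] at this
      exact this.symm
    · apply Subtype.ext
      ext u
      simp
      exact (e X).symm_apply_apply u

theorem aut_sub {V : Type*} (U G : SimpleGraph V) (hUG : U ≤ G) (σ : Equiv.Perm V)
    (h : IsAut G σ) : ∀ u v, U.Adj (σ u) (σ v) → G.Adj u v :=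
  fun u v huv => (h u v).1 (hUG huv)

theorem cap_eq {V : Type*} (U G : SimpleGraph V)
    (h : ∀ σ : Equiv.Perm V, IsAut U σ → IsAut G σ) : autCapCard U G = autCard U :=
  Nat.card_congr (Equiv.subtypeEquivRight fun σ => ⟨fun x => x.1, fun x => ⟨x, h σ x⟩⟩)

theorem rhs_iff {V : Type*} (U G : SimpleGraph V) :
    (∀ U₀ : SimpleGraph V, U₀ ≤ G → Nonempty (U₀ ≃g U) →
        ∀ σ : Equiv.Perm V, U₀.map σ.toEmbedding = U → IsAut G σ) ↔
    ∀ σ : Equiv.Perm V, (∀ u v, U.Adj (σ u) (σ v) → G.Adj u v) → IsAut G σ := by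
  constructor
  · intro h σ hσ
    refine h (U.comap σ) (fun u v h => hσ u v h) ⟨⟨σ, Iff.rfl⟩⟩ σ ?_
    ext u v
    simp only [SimpleGraph.map_adj, SimpleGraph.comap_adj]
    constructor
    · rintro ⟨a, b, hab, rfl, rfl⟩
      exact hab
    · intro huv
      exact ⟨σ.symm u, σ.symm v, by simpa using huv, by simp, by simp⟩
  · rintro h U₀ hU - σ rfl
    refine h σ fun u v huv => hU ?_
    exact (SimpleGraph.map_adj_apply (f := σ.toEmbedding)).1 huv

/-- **Theorem 3(ii).** `U` is a strong fixing subgraph of `G` iff for every spanning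
subgraph `U₀ ≤ G` isomorphic to `U`, every permutation `σ` with `σ(U₀) = U` is an
automorphism of `G`. -/
theorem isStrongFixing_iff {V : Type*} [Fintype V] (U G : SimpleGraph V) (hUG : U ≤ G) :
    IsStrongFixing U G ↔
      ∀ U₀ : SimpleGraph V, U₀ ≤ G → Nonempty (U₀ ≃g U) →
        ∀ σ : Equiv.Perm V, U₀.map σ.toEmbedding = U → IsAut G σ := by
  classical
  rw [rhs_iff]
  have key := card_key U G
  constructor
  · rintro ⟨⟨-, hs⟩, hU⟩ σ hσ
    rw [cap_eq U G hU] at hs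
    have hle : Nat.card {σ : Equiv.Perm V // ∀ u v, U.Adj (σ u) (σ v) → G.Adj u v}
        ≤ Nat.card {σ : Equiv.Perm V // IsAut G σ} := by
      rw [key, hs]
      exact Nat.div_mul_le_self _ _
    have hsub : {σ : Equiv.Perm V | IsAut G σ} ⊆
        {σ : Equiv.Perm V | ∀ u v, U.Adj (σ u) (σ v) → G.Adj u v} :=
      fun σ h => aut_sub U G hUG σ h
    have heq := Set.eq_of_subset_of_ncard_le hsub hle (Set.toFinite _)
    have : σ ∈ {σ : Equiv.Perm V | IsAut G σ} := by rw [heq]; exact hσ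
    exact this
  · intro h
    have hU : ∀ σ : Equiv.Perm V, IsAut U σ → IsAut G σ := fun σ hσ =>
      h σ fun u v huv => hUG ((hσ u v).1 huv)
    refine ⟨⟨hUG, ?_⟩, hU⟩
    rw [cap_eq U G hU]
    have h1 : autCard G = sCard U G * autCard U := by
      rw [← key]
      exact Nat.card_congr (Equiv.subtypeEquivRight fun σ => ⟨aut_sub U G hUG σ, h σ⟩)
    have hpos : 0 < autCard U := by
      haveI : Nonempty {σ : Equiv.Perm V // IsAut U σ} := ⟨⟨1, fun _ _ => Iff.rfl⟩⟩
      exact Nat.card_pos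
    rw [h1, Nat.mul_div_cancel _ hpos]
end

section
/- Let G be a finite simple graph on a finite vertex set V, let U ≤ G be a fixing subgraph of G, and let U₀ ≤ G be a spanning subgraph isomorphic to U. Then U₀ is a fixing subgraph of G; moreover, if U is a strong fixing subgraph of G then so is U₀. -/
/-- The automorphism group as a subgroup. -/
def autGrp {V : Type*} (G : SimpleGraph V) : Subgroup (Equiv.Perm V) where
  carrier := {σ | IsAut G σ}
  one_mem' := fun u v => Iff.rfl
  mul_mem' := fun {a b} ha hb u v => (ha (b u) (b v)).trans (hb u v)
  inv_mem' := fun {a} ha u v => by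
    have := ha (a⁻¹ u) (a⁻¹ v)
    simpa using this.symm

/-- Action of the automorphism group on graphs. -/
@[reducible] def autAct {V : Type*} (G : SimpleGraph V) :
    MulAction (autGrp G) (SimpleGraph V) where
  smul σ U := U.comap (σ.1⁻¹ : Equiv.Perm V)
  one_smul U := by
    ext a b
    exact Iff.rfl
  mul_smul σ τ U := by
    ext a b
    change U.Adj ((σ.1 * τ.1)⁻¹ a) ((σ.1 * τ.1)⁻¹ b) ↔ U.Adj (τ.1⁻¹ (σ.1⁻¹ a)) (τ.1⁻¹ (σ.1⁻¹ b))
    rw [mul_inv_rev]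
    exact Iff.rfl

lemma exists_aut_of_fixing {V : Type*} [Fintype V] (U G U₀ : SimpleGraph V)
    (hU : IsFixing U G) (hU₀ : U₀ ≤ G) (hiso : Nonempty (U₀ ≃g U)) :
    ∃ σ : Equiv.Perm V, IsAut G σ ∧ ∀ a b, U₀.Adj (σ a) (σ b) ↔ U.Adj a b := by
  classical
  letI := autAct G
  have hsm : ∀ (σ : autGrp G) (a b : V), (σ • U).Adj a b ↔ U.Adj (σ.1⁻¹ a) (σ.1⁻¹ b) :=
    fun σ a b => Iff.rfl
  have hsub : MulAction.orbit (autGrp G) U ⊆ {U' | U' ≤ G ∧ Nonempty (U' ≃g U)} := by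
    rintro _ ⟨σ, rfl⟩
    refine ⟨fun a b h => ?_, ⟨⟨σ.1⁻¹, ?_⟩⟩⟩
    · have h1 := hU.1 ((hsm σ a b).1 h)
      have h2 := σ.2 (σ.1⁻¹ a) (σ.1⁻¹ b)
      simpa using h2.2 h1
    · intro a b
      exact (hsm σ a b).symm
  have hstab : Nat.card (MulAction.stabilizer (autGrp G) U) = autCapCard U G := by
    refine Nat.card_congr ⟨fun σ => ⟨σ.1.1, ?_, σ.1.2⟩, fun σ => ⟨⟨σ.1, σ.2.2⟩, ?_⟩,
      fun _ => rfl, fun _ => rfl⟩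
    · intro a b
      have h : σ.1 • U = U := σ.2
      have h2 := hsm σ.1 (σ.1.1 a) (σ.1.1 b)
      rw [h] at h2
      simpa using h2
    · rw [MulAction.mem_stabilizer_iff]
      ext a b
      rw [hsm]
      have := σ.2.1 (σ.1⁻¹ a) (σ.1⁻¹ b)
      simpa using this.symm
  have hcard : (MulAction.orbit (autGrp G) U).ncard
      = ({U' | U' ≤ G ∧ Nonempty (U' ≃g U)} : Set (SimpleGraph V)).ncard := by
    have h1 := (MulAction.stabilizer (autGrp G) U).card_mul_index
    rw [MulAction.index_stabilizer, hstab] at h1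
    have h2 := hU.2
    have hpos : 0 < autCapCard U G := by
      rw [← hstab]
      exact Nat.card_pos
    have h3 : Nat.card (autGrp G) = autCard G := rfl
    rw [← h3, ← h1, Nat.mul_div_cancel_left _ hpos] at h2
    exact h2.symm
  have heq := Set.eq_of_subset_of_ncard_le hsub hcard.ge (Set.toFinite _)
  have hmem : U₀ ∈ MulAction.orbit (autGrp G) U := by
    rw [heq]
    exact ⟨hU₀, hiso⟩
  obtain ⟨σ, hσ⟩ := hmem
  refine ⟨σ.1, σ.2, fun a b => ?_⟩
  have hσ' : σ • U = U₀ := hσ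
  rw [← hσ', hsm]
  simp

lemma isAut_conj {V : Type*} {G H : SimpleGraph V} {σ : Equiv.Perm V}
    (hσ : ∀ a b, H.Adj (σ a) (σ b) ↔ G.Adj a b) (τ : Equiv.Perm V) :
    IsAut H (MulAut.conj σ τ) ↔ IsAut G τ := by
  constructor
  · intro h a b
    have := h (σ a) (σ b)
    simpa [hσ] using this
  · intro h a b
    have h1 := h (σ⁻¹ a) (σ⁻¹ b)
    have h2 := hσ (σ⁻¹ a) (σ⁻¹ b)
    have h3 : ∀ x, σ (σ⁻¹ x) = x := fun x => σ.apply_symm_apply x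
    rw [h3, h3] at h2
    simp only [MulAut.conj_apply, Equiv.Perm.mul_apply]
    rw [hσ, h1, h2]

/-- **Corollary 4.** If `U` is a fixing subgraph of `G` and `U₀ ≤ G` is isomorphic
to `U`, then `U₀` is a fixing subgraph of `G`; and if moreover `U` is a strong fixing
subgraph then so is `U₀`. -/
theorem isFixing_of_iso {V : Type*} [Fintype V] (U G U₀ : SimpleGraph V)
    (hU : IsFixing U G) (hU₀ : U₀ ≤ G) (hiso : Nonempty (U₀ ≃g U)) :
    IsFixing U₀ G ∧ (IsStrongFixing U G → IsStrongFixing U₀ G) := by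
  obtain ⟨σ, hG, hσ⟩ := exists_aut_of_fixing U G U₀ hU hU₀ hiso
  obtain ⟨e⟩ := hiso
  have hs : sCard U₀ G = sCard U G := by
    refine Nat.card_congr (Equiv.subtypeEquivRight fun U' => and_congr_right fun _ => ?_)
    exact ⟨fun ⟨f⟩ => ⟨f.trans e⟩, fun ⟨f⟩ => ⟨f.trans e.symm⟩⟩
  have hc : autCapCard U G = autCapCard U₀ G :=
    Nat.card_congr ((MulAut.conj σ).toEquiv.subtypeEquiv fun τ =>
      and_congr (isAut_conj hσ τ).symm (isAut_conj hG τ).symm)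
  have hF : IsFixing U₀ G := ⟨hU₀, by rw [hs, ← hc]; exact hU.2⟩
  refine ⟨hF, fun h => ⟨hF, fun τ hτ => ?_⟩⟩
  obtain ⟨ρ, rfl⟩ := (MulAut.conj σ).surjective τ
  exact (isAut_conj hG ρ).2 (h.2 ρ ((isAut_conj hσ ρ).1 hτ))
end

section
/- Let G be a finite simple graph on a finite vertex set V and let U ≤ G be a spanning subgraph. Then U is a strong fixing subgraph of G if and only if x(U;G) = 1, i.e., G is the unique graph X on V (up to equality, not just isomorphism) with U ≤ X and X isomorphic to G. -/
/-- Permutations embedding `U` into `G`. -/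
def EmbP {V : Type*} (U G : SimpleGraph V) (p : Equiv.Perm V) : Prop :=
  ∀ u v, U.Adj u v → G.Adj (p u) (p v)

/-- The automorphism group as a subgroup. -/
def autSub {V : Type*} (G : SimpleGraph V) : Subgroup (Equiv.Perm V) where
  carrier := {σ | IsAut G σ}
  mul_mem' := by
    intro a b ha hb u v
    rw [Equiv.Perm.mul_apply, Equiv.Perm.mul_apply, ha, hb]
  one_mem' := by
    intro u v
    rfl
  inv_mem' := by
    intro a ha u v
    rw [← ha]
    simp

theorem card_embP {V : Type*} (U G : SimpleGraph V) :
    Nat.card {p : Equiv.Perm V // EmbP U G p} = sCard U G * autCard U := by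
  unfold sCard autCard
  rw [← Nat.card_prod]
  symm
  let e : ∀ x : {U' : SimpleGraph V // U' ≤ G ∧ Nonempty (U' ≃g U)}, x.1 ≃g U :=
    fun x => Classical.choice x.2.2
  have key : ∀ (x : {U' : SimpleGraph V // U' ≤ G ∧ Nonempty (U' ≃g U)})
      (σ : {σ : Equiv.Perm V // IsAut U σ}) (u v : V),
      x.1.Adj ((σ.1.trans (e x).toEquiv.symm) u) ((σ.1.trans (e x).toEquiv.symm) v)
        ↔ U.Adj u v := by
    intro x σ u v
    rw [← σ.2 u v]
    exact (e x).symm.map_adj_iff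
  let f : {U' : SimpleGraph V // U' ≤ G ∧ Nonempty (U' ≃g U)} × {σ : Equiv.Perm V // IsAut U σ} →
      {p : Equiv.Perm V // EmbP U G p} := fun y =>
    ⟨y.2.1.trans (e y.1).toEquiv.symm, fun u v h => y.1.2.1 ((key y.1 y.2 u v).2 h)⟩
  refine Nat.card_congr (Equiv.ofBijective f ⟨?_, ?_⟩)
  · rintro ⟨x, σ⟩ ⟨y, τ⟩ h
    have h1 : σ.1.trans (e x).toEquiv.symm = τ.1.trans (e y).toEquiv.symm :=
      congrArg Subtype.val h
    have hxy : x = y := by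
      apply Subtype.ext
      ext a b
      obtain ⟨u, rfl⟩ := (σ.1.trans (e x).toEquiv.symm).surjective a
      obtain ⟨v, rfl⟩ := (σ.1.trans (e x).toEquiv.symm).surjective b
      rw [key, h1, key]
    subst hxy
    have : σ = τ := by
      apply Subtype.ext
      ext u
      exact (e x).toEquiv.symm.injective (Equiv.congr_fun h1 u)
    rw [this]
  · rintro ⟨p, hp⟩
    let x : {U' : SimpleGraph V // U' ≤ G ∧ Nonempty (U' ≃g U)} :=
      ⟨U.comap p.symm, by
        intro a b h
        have := hp _ _ h
        simpa using this, ⟨⟨p.symm, Iff.rfl⟩⟩⟩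
    have hx : ∀ u v, x.1.Adj (p u) (p v) ↔ U.Adj u v := by
      intro u v
      change U.Adj (p.symm (p u)) (p.symm (p v)) ↔ _
      simp
    refine ⟨(x, ⟨p.trans (e x).toEquiv, ?_⟩), ?_⟩
    · intro u v
      rw [← hx u v]
      exact (e x).map_adj_iff
    · apply Subtype.ext
      ext u
      exact (e x).toEquiv.symm_apply_apply (p u)

theorem xCard_eq_one {V : Type*} (U G : SimpleGraph V) (hUG : U ≤ G) :
    xCard U G = 1 ↔ ∀ p, EmbP U G p → IsAut G p := by
  unfold xCard
  rw [Nat.card_eq_one_iff_unique]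
  constructor
  · rintro ⟨hs, -⟩ p hp
    have h := congrArg Subtype.val (hs.elim ⟨G.comap p, fun a b h => hp a b h, ⟨⟨p, Iff.rfl⟩⟩⟩
      ⟨G, hUG, ⟨SimpleGraph.Iso.refl⟩⟩)
    intro u v
    change (G.comap p).Adj u v ↔ _
    rw [show G.comap p = G from h]
  · intro h
    refine ⟨⟨?_⟩, ⟨⟨G, hUG, ⟨SimpleGraph.Iso.refl⟩⟩⟩⟩
    have : ∀ x : {X : SimpleGraph V // U ≤ X ∧ Nonempty (X ≃g G)}, x.1 = G := by
      rintro ⟨X, hX, ⟨e⟩⟩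
      have := h e.toEquiv (fun u v huv => e.map_adj_iff.2 (hX huv))
      ext u v
      rw [← this u v]
      exact e.map_adj_iff.symm
    intro x y
    exact Subtype.ext ((this x).trans (this y).symm)

/-- **Theorem 5(ii).** `U` is a strong fixing subgraph of `G` iff `x(U;G) = 1`,
i.e. `G` is the unique graph `X` on `V` with `U ≤ X` and `X ≅ G`. -/
theorem isStrongFixing_iff_xCard {V : Type*} [Fintype V] (U G : SimpleGraph V) (hUG : U ≤ G) :
    IsStrongFixing U G ↔ xCard U G = 1 := by
  rw [xCard_eq_one U G hUG]
  have hc := card_embP U G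
  have hsub : ∀ p, IsAut G p → EmbP U G p := fun p hp u v h => (hp u v).2 (hUG h)
  have hpos : 0 < autCard U := Nat.card_pos (α := autSub U)
  have hcap : (∀ σ : Equiv.Perm V, IsAut U σ → IsAut G σ) → autCapCard U G = autCard U := by
    intro h
    unfold autCapCard autCard
    exact Nat.card_congr (Equiv.subtypeEquivRight fun σ => ⟨fun q => q.1, fun q => ⟨q, h σ q⟩⟩)
  constructor
  · rintro ⟨⟨-, hs⟩, hA⟩ p hp
    rw [hcap hA] at hs
    have hd : autCard U ∣ autCard G :=
      Subgroup.card_dvd_of_le (H := autSub U) (K := autSub G) (fun σ h => hA σ h)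
    rw [hs, Nat.div_mul_cancel hd] at hc
    have heq : {p | IsAut G p} = {p | EmbP U G p} :=
      Set.eq_of_subset_of_ncard_le (fun p hp => hsub p hp) hc.le (Set.toFinite _)
    exact heq.symm.subset hp
  · intro h
    have hA : ∀ σ : Equiv.Perm V, IsAut U σ → IsAut G σ :=
      fun σ hσ => h σ fun u v huv => hUG ((hσ u v).2 huv)
    refine ⟨⟨hUG, ?_⟩, hA⟩
    rw [hcap hA]
    have : autCard G = sCard U G * autCard U := by
      rw [← hc]
      exact Nat.card_congr (Equiv.subtypeEquivRight fun σ => ⟨hsub σ, h σ⟩)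
    rw [this, Nat.mul_div_cancel _ hpos]
end

section
/- Let G be a finite simple graph on a finite vertex set V, let U be a strong fixing subgraph of G, and let K be a simple graph on V with U ≤ K ≤ G. Then every automorphism of K is an automorphism of G, and K is a strong fixing subgraph of G. -/
theorem card_emb_aux {V : Type*} (U G : SimpleGraph V) :
    Nat.card {p : Equiv.Perm V // ∀ u v, U.Adj u v → G.Adj (p u) (p v)} =
      sCard U G * Nat.card {σ : Equiv.Perm V // IsAut U σ} := by
  classical
  unfold sCard
  rw [← Nat.card_prod]
  symm
  let φ : ∀ x : {U' : SimpleGraph V // U' ≤ G ∧ Nonempty (U' ≃g U)}, x.1 ≃g U :=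
    fun x => x.2.2.some
  have key : ∀ (x : {U' : SimpleGraph V // U' ≤ G ∧ Nonempty (U' ≃g U)})
      (σ : {σ : Equiv.Perm V // IsAut U σ}) (u v : V),
      x.1.Adj ((φ x).symm (σ.1 u)) ((φ x).symm (σ.1 v)) ↔ U.Adj u v := fun x σ u v =>
    ((φ x).symm.map_adj_iff).trans (σ.2 u v)
  let f : {U' : SimpleGraph V // U' ≤ G ∧ Nonempty (U' ≃g U)} ×
      {σ : Equiv.Perm V // IsAut U σ} →
      {p : Equiv.Perm V // ∀ u v, U.Adj u v → G.Adj (p u) (p v)} := fun x =>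
    ⟨x.2.1.trans (φ x.1).symm.toEquiv, fun u v h => x.1.2.1 ((key x.1 x.2 u v).2 h)⟩
  refine Nat.card_congr (Equiv.ofBijective f ⟨?_, ?_⟩)
  · rintro ⟨x, σ⟩ ⟨y, τ⟩ h
    have h1 : ∀ u, (φ x).symm (σ.1 u) = (φ y).symm (τ.1 u) := fun u =>
      congrArg (fun p => p.1 u) h
    have hxy : x = y := by
      apply Subtype.ext
      ext a b
      obtain ⟨u, rfl⟩ := (σ.1.trans (φ x).symm.toEquiv).surjective a
      obtain ⟨v, rfl⟩ := (σ.1.trans (φ x).symm.toEquiv).surjective b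
      change x.1.Adj ((φ x).symm (σ.1 u)) ((φ x).symm (σ.1 v)) ↔
        y.1.Adj ((φ x).symm (σ.1 u)) ((φ x).symm (σ.1 v))
      rw [key, h1, h1, key]
    subst hxy
    have : σ = τ := by
      apply Subtype.ext
      ext u
      exact (φ x).symm.injective (h1 u)
    rw [this]
  · rintro ⟨p, hp⟩
    let x : {U' : SimpleGraph V // U' ≤ G ∧ Nonempty (U' ≃g U)} :=
      ⟨U.comap p.symm, by
        intro a b h
        have := hp _ _ h
        simpa using this, ⟨⟨p.symm, Iff.rfl⟩⟩⟩
    refine ⟨(x, ⟨p.trans (φ x).toEquiv, ?_⟩), ?_⟩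
    · intro u v
      refine ((φ x).map_adj_iff).trans ?_
      change U.Adj (p.symm (p u)) (p.symm (p v)) ↔ _
      simp
    · apply Subtype.ext
      ext u
      change (φ x).symm ((φ x) (p u)) = p u
      simp

theorem autCapCard_aux {V : Type*} (U G : SimpleGraph V)
    (h : ∀ σ : Equiv.Perm V, IsAut U σ → IsAut G σ) :
    autCapCard U G = Nat.card {σ : Equiv.Perm V // IsAut U σ} := by
  unfold autCapCard
  exact Nat.card_congr (Equiv.subtypeEquivRight fun σ => ⟨fun a => a.1, fun a => ⟨a, h σ a⟩⟩)

/-- **Theorem 5(iii).** If `U` is a strong fixing subgraph of `G` and `U ≤ K ≤ G`,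
then every automorphism of `K` is an automorphism of `G`, and `K` is a strong fixing
subgraph of `G`. -/
theorem isStrongFixing_of_le {V : Type*} [Fintype V] (U K G : SimpleGraph V)
    (hU : IsStrongFixing U G) (hUK : U ≤ K) (hKG : K ≤ G) :
    (∀ σ : Equiv.Perm V, IsAut K σ → IsAut G σ) ∧ IsStrongFixing K G := by
  have hE : ∀ p : Equiv.Perm V, (∀ u v, U.Adj u v → G.Adj (p u) (p v)) → IsAut G p := by
    have hc := card_emb_aux U G
    obtain ⟨⟨hUG, hs⟩, hA⟩ := hU
    rw [hs, autCapCard_aux U G hA] at hc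
    have hle := hc.le.trans (Nat.div_mul_le_self _ _)
    have hsub : {p : Equiv.Perm V | IsAut G p} ⊆
        {p : Equiv.Perm V | ∀ u v, U.Adj u v → G.Adj (p u) (p v)} :=
      fun p hp u v h => (hp u v).2 (hUG h)
    have heq := Set.eq_of_subset_of_ncard_le hsub hle (Set.toFinite _)
    intro p hp
    have : p ∈ {p : Equiv.Perm V | IsAut G p} := by rw [heq]; exact hp
    exact this
  have hK : ∀ σ : Equiv.Perm V, IsAut K σ → IsAut G σ := fun σ h =>
    hE σ fun u v huv => hKG ((h u v).2 (hUK huv))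
  refine ⟨hK, ⟨hKG, ?_⟩, hK⟩
  have hc := card_emb_aux K G
  have h2 : Nat.card {p : Equiv.Perm V // ∀ u v, K.Adj u v → G.Adj (p u) (p v)} = autCard G :=
    Nat.card_congr (Equiv.subtypeEquivRight fun p =>
      ⟨fun h => hE p fun u v huv => h u v (hUK huv), fun h u v huv => (h u v).2 (hKG huv)⟩)
  rw [autCapCard_aux K G hK, ← h2, hc]
  have : Nonempty {σ : Equiv.Perm V // IsAut K σ} := ⟨⟨1, fun _ _ => Iff.rfl⟩⟩
  exact (Nat.mul_div_cancel _ Nat.card_pos).symm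
end

section
/- Let G be a finite simple graph on n ≥ 3 vertices. Then G ∈ F*(HAM) (G is hamiltonian and every hamiltonian cycle of G is a strong fixing subgraph of G) if and only if G is isomorphic to the cycle graph C_n, or to the complete graph K_n, or (when n is even) to the complete bipartite graph K_{n/2,n/2}. -/
/-- Cycle graph on `ZMod n`. -/
def cycZ (n : ℕ) (hn : 3 ≤ n) : SimpleGraph (ZMod n) where
  Adj i j := j = i + 1 ∨ i = j + 1
  symm := ⟨fun i j h => by tauto⟩
  loopless := ⟨fun i h => by
    have : Fact (1 < n) := ⟨by omega⟩
    simp at h⟩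

theorem core_S {n : ℕ} (hn : 3 ≤ n) (S : ℕ → Prop) (h1 : S 1)
    (hsym : ∀ k, k ≤ n → S k → S (n - k))
    (hup : ∀ k, 2 ≤ k → k + 3 ≤ n → S k → S (k + 2))
    (h2 : 6 ≤ n → S 2 → S (n - 3)) :
    (∀ k, 2 ≤ k → k + 2 ≤ n → ¬ S k) ∨ (∀ k, 1 ≤ k → k < n → S k) ∨
    (Even n ∧ ∀ k, k < n → (S k ↔ k % 2 = 1) ∨ k = 0) := by
  have hup' : ∀ t k, 2 ≤ k → k + 2 * t + 1 ≤ n → S k → S (k + 2 * t) := by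
    intro t
    induction t with
    | zero => intro k _ _ h; simpa using h
    | succ t ih =>
      intro k hk hkn h
      have := hup (k + 2 * t) (by omega) (by omega) (ih k hk (by omega) h)
      exact this
  have hUp : ∀ k j, 2 ≤ k → k ≤ j → j < n → k % 2 = j % 2 → S k → S j := by
    intro k j hk hj hjn hp h
    have := hup' ((j - k) / 2) k hk (by omega) h
    rwa [show k + 2 * ((j - k) / 2) = j by omega] at this
  have hAll : ∀ k j, 2 ≤ k → k + 2 ≤ n → 1 ≤ j → j < n → k % 2 = j % 2 → S k → S j := by
    intro k j hk hkn hj hjn hp h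
    rcases le_total k j with h' | h'
    · exact hUp k j hk h' hjn hp h
    · have := hUp (n - k) (n - j) (by omega) (by omega) (by omega) (by omega)
        (hsym k (by omega) h)
      have := hsym (n - j) (by omega) this
      rwa [show n - (n - j) = j by omega] at this
  by_cases hex : ∃ k, 2 ≤ k ∧ k + 2 ≤ n ∧ S k
  swap
  · left; intro k a b c; exact hex ⟨k, a, b, c⟩
  right
  obtain ⟨k, hk, hkn, hS⟩ := hex
  have two : ∀ a b, 2 ≤ a → a + 2 ≤ n → 2 ≤ b → b + 2 ≤ n → a % 2 ≠ b % 2 → S a → S b →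
      ∀ k, 1 ≤ k → k < n → S k := by
    intro a b ha ha' hb hb' hab hSa hSb k hk hkn
    by_cases h : a % 2 = k % 2
    · exact hAll a k ha ha' hk hkn h hSa
    · exact hAll b k hb hb' hk hkn (by omega) hSb
  by_cases hodd : n % 2 = 1
  · left
    exact two k (n - k) hk hkn (by omega) (by omega) (by omega) hS (hsym k (by omega) hS)
  by_cases he : ∃ k, 2 ≤ k ∧ k + 2 ≤ n ∧ S k ∧ k % 2 = 0
  · left
    obtain ⟨k, hk, hkn, hS, hk2⟩ := he
    by_cases h6 : 6 ≤ n
    · have hS2 := hAll k 2 hk hkn (by omega) (by omega) (by omega) hS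
      exact two k (n - 3) hk hkn (by omega) (by omega) (by omega) hS (h2 h6 hS2)
    · have : n = 4 := by omega
      subst this
      have : k = 2 := by omega
      subst this
      intro j hj hj4
      have h3 := hsym 1 (by omega) h1
      interval_cases j <;> assumption
  · right
    refine ⟨Nat.even_iff.2 (by omega), fun j hj => ?_⟩
    by_cases hj0 : j = 0
    · right; exact hj0
    left
    constructor
    · intro h
      by_contra hc
      exact he ⟨j, by omega, by omega, h, by omega⟩
    · intro h
      have hk1 : k % 2 = 1 := by
        by_contra hc
        exact he ⟨k, hk, hkn, hS, by omega⟩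
      exact hAll k j hk hkn (by omega) hj (by omega) hS

theorem zrep {n : ℕ} (hn : 3 ≤ n) (a : ZMod n) : ∃ j : ℕ, j < n ∧ a = (j : ZMod n) := by
  have : NeZero n := ⟨by omega⟩
  exact ⟨a.val, ZMod.val_lt a, (ZMod.natCast_zmod_val a).symm⟩

theorem core_adj {n : ℕ} (hn : 3 ≤ n) (H : SimpleGraph (ZMod n))
    (h1 : ∀ i, H.Adj i (i + 1))
    (hb : ∀ π : Equiv.Perm (ZMod n), (∀ i, H.Adj (π i) (π (i + 1))) →
      ∀ i j, H.Adj (π i) (π j) ↔ H.Adj (π (i + 1)) (π (j + 1))) :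
    (∀ i j, H.Adj i j ↔ (cycZ n hn).Adj i j) ∨ (∀ i j, i ≠ j → H.Adj i j) ∨
    (Even n ∧ ∀ i j, H.Adj i j ↔ i.val % 2 ≠ j.val % 2) := by
  have : NeZero n := ⟨by omega⟩
  have hn0 : ((n : ℕ) : ZMod n) = 0 := ZMod.natCast_self n
  have hsh : ∀ i j, H.Adj i j ↔ H.Adj (i + 1) (j + 1) := by
    simpa using hb 1 (by simpa using h1)
  have hshN : ∀ (c : ℕ) i j, H.Adj i j ↔ H.Adj (i + c) (j + c) := by
    intro c
    induction c with
    | zero => simp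
    | succ c ih =>
      intro i j
      rw [ih, hsh]
      push_cast
      rw [add_assoc, add_assoc]
  set S : ℕ → Prop := fun k => H.Adj 0 (k : ZMod n) with hSdef
  have hS : ∀ a b : ℕ, a ≤ b → (H.Adj (a : ZMod n) (b : ZMod n) ↔ S (b - a)) := by
    intro a b hab
    rw [hSdef]
    simp only
    rw [hshN a 0, zero_add, ← Nat.cast_add, Nat.sub_add_cancel hab]
  have hS' : ∀ a b : ℕ, b ≤ a → (H.Adj (a : ZMod n) (b : ZMod n) ↔ S (a - b)) := by
    intro a b hab
    rw [H.adj_comm, hS b a hab]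
  have hS1 : S 1 := by simpa [hSdef] using h1 0
  have hsym : ∀ k, k ≤ n → S k → S (n - k) := by
    intro k hk h
    rw [← hS k n hk, hn0, H.adj_comm]
    exact h
  have hpi : ∀ k, 2 ≤ k → k + 2 ≤ n → S k → ∃ π : Equiv.Perm (ZMod n),
      (∀ i, H.Adj (π i) (π (i + 1))) ∧
      ∀ j : ℕ, j < n → π (j : ZMod n) = ((if 1 ≤ j ∧ j ≤ k then k + 1 - j else j : ℕ) : ZMod n) := by
    intro k hk hkn hSk
    let f : ZMod n → ZMod n := fun x =>
      ((if 1 ≤ x.val ∧ x.val ≤ k then k + 1 - x.val else x.val : ℕ) : ZMod n)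
    have hf : ∀ j : ℕ, j < n →
        f (j : ZMod n) = ((if 1 ≤ j ∧ j ≤ k then k + 1 - j else j : ℕ) : ZMod n) := by
      intro j hj
      simp only [f, ZMod.val_cast_of_lt hj]
    have hinv : Function.Involutive f := by
      intro x
      obtain ⟨j, hj, rfl⟩ := zrep hn x
      rw [hf j hj]
      split_ifs with h
      · rw [hf _ (by omega), if_pos (by omega)]
        congr 1; omega
      · rw [hf j hj, if_neg h]
    refine ⟨hinv.toPerm f, ?_, hf⟩
    intro x
    obtain ⟨j, hj, rfl⟩ := zrep hn x
    change H.Adj (f _) (f _)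
    rcases Nat.lt_or_ge (j + 1) n with hj1 | hj1
    · rw [← Nat.cast_succ, hf j hj, hf (j + 1) hj1]
      by_cases h0 : j = 0
      · subst h0
        rw [if_neg (by omega), if_pos (by omega), hS _ _ (by omega)]
        simpa using hSk
      by_cases hjk : j < k
      · rw [if_pos (by omega), if_pos (by omega), hS' _ _ (by omega)]
        rwa [show k + 1 - j - (k + 1 - (j + 1)) = 1 by omega]
      by_cases hjk : j = k
      · rw [if_pos (by omega), if_neg (by omega), hS _ _ (by omega)]
        rwa [show j + 1 - (k + 1 - j) = k by omega]
      · rw [if_neg (by omega), if_neg (by omega), hS _ _ (by omega)]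
        rwa [show j + 1 - j = 1 by omega]
    · have hjn : j + 1 = n := by omega
      rw [← Nat.cast_succ, Nat.succ_eq_add_one, hjn, hn0, ← Nat.cast_zero, hf j hj, hf 0 (by omega),
        if_neg (by omega), if_neg (by omega)]
      have := h1 (j : ZMod n)
      rwa [← Nat.cast_succ, Nat.succ_eq_add_one, hjn, hn0, ← Nat.cast_zero] at this
  have hup : ∀ k, 2 ≤ k → k + 3 ≤ n → S k → S (k + 2) := by
    intro k hk hkn hSk
    obtain ⟨π, hπ, hv⟩ := hpi k hk (by omega) hSk
    have := hb π hπ ((n - 2 : ℕ) : ZMod n) ((1 : ℕ) : ZMod n)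
    rw [← Nat.cast_succ, ← Nat.cast_succ, hv _ (by omega), hv _ (by omega), hv _ (by omega),
      hv _ (by omega), if_neg (by omega), if_pos (by omega), if_neg (by omega), if_pos (by omega),
      hS' _ _ (by omega), hS' _ _ (by omega),
      show Nat.succ (n - 2) - (k + 1 - Nat.succ 1) = n - k by omega] at this
    have := hsym _ (by omega) (this.2 (hsym k (by omega) hSk))
    rwa [show n - (n - 2 - (k + 1 - 1)) = k + 2 by omega] at this
  have h2 : 6 ≤ n → S 2 → S (n - 3) := by
    intro h6 hSk
    obtain ⟨π, hπ, hv⟩ := hpi 2 le_rfl (by omega) hSk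
    have := hb π hπ ((0 : ℕ) : ZMod n) ((n - 2 : ℕ) : ZMod n)
    rw [← Nat.cast_succ, ← Nat.cast_succ, hv _ (by omega), hv _ (by omega), hv _ (by omega),
      hv _ (by omega), if_neg (by omega), if_neg (by omega), if_pos (by omega), if_neg (by omega),
      hS _ _ (by omega), hS _ _ (by omega),
      show n - 2 - 0 = n - 2 by omega,
      show Nat.succ (n - 2) - (2 + 1 - Nat.succ 0) = n - 3 by omega] at this
    exact this.1 (hsym 2 (by omega) hSk)
  have key := core_S hn S hS1 hsym hup h2
  -- reduce to a < b
  have hS0 : ¬ S 0 := by simp [hSdef]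
  rcases key with h | h | ⟨hev, h⟩
  · left
    intro x y
    constructor
    · have aux : ∀ a b : ℕ, a < b → b < n → H.Adj (a : ZMod n) (b : ZMod n) →
          ((b : ZMod n) = a + 1 ∨ (a : ZMod n) = b + 1) := by
        intro a b hab hbn hadj
        rw [hS a b hab.le] at hadj
        by_cases hc : b = a + 1
        · left; subst hc; push_cast; rfl
        · have : b + 1 = a + n := by
            by_contra hne
            exact h (b - a) (by omega) (by omega) hadj
          right
          rw [← Nat.cast_succ, Nat.succ_eq_add_one, this]
          simp
      obtain ⟨a, ha, rfl⟩ := zrep hn x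
      obtain ⟨b, hb', rfl⟩ := zrep hn y
      intro hadj
      rcases lt_trichotomy a b with hab | hab | hab
      · exact aux a b hab hb' hadj
      · subst hab; exact absurd hadj (H.loopless.irrefl _)
      · exact (aux b a hab ha hadj.symm).symm
    · rintro (h | h)
      · rw [h]; exact h1 x
      · rw [h]; exact (h1 y).symm
  · right; left
    intro x y hxy
    obtain ⟨a, ha, rfl⟩ := zrep hn x
    obtain ⟨b, hb', rfl⟩ := zrep hn y
    rcases lt_trichotomy a b with hab | hab | hab
    · rw [hS _ _ hab.le]; exact h _ (by omega) (by omega)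
    · subst hab; exact absurd rfl hxy
    · rw [hS' _ _ hab.le]; exact h _ (by omega) (by omega)
  · right; right
    refine ⟨hev, fun x y => ?_⟩
    have h' : ∀ k, k < n → (S k ↔ k % 2 = 1) := by
      intro k hk
      rcases h k hk with h | h
      · exact h
      · subst h; simp [hS0]
    obtain ⟨a, ha, rfl⟩ := zrep hn x
    obtain ⟨b, hb', rfl⟩ := zrep hn y
    rw [ZMod.val_cast_of_lt ha, ZMod.val_cast_of_lt hb']
    rcases le_total a b with hab | hab
    · rw [hS _ _ hab, h' _ (by omega)]; omega
    · rw [hS' _ _ hab, h' _ (by omega)]; omega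

theorem reg_eq {V : Type*} [Finite V] {U H : SimpleGraph V} (hle : U ≤ H)
    (hU : ∀ v, Nat.card {w // U.Adj v w} = 2) (hH : ∀ v, Nat.card {w // H.Adj v w} = 2) :
    U = H := by
  refine le_antisymm hle fun v w hvw => ?_
  have : {w | U.Adj v w} = {w | H.Adj v w} := by
    have h1 : {w | U.Adj v w}.ncard = 2 := hU v
    have h2 : {w | H.Adj v w}.ncard = 2 := hH v
    have hsub : {w | U.Adj v w} ⊆ {w | H.Adj v w} := fun x hx => hle hx
    exact Set.eq_of_subset_of_ncard_le hsub (by rw [h1, h2])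
  have h3 : w ∈ {w | H.Adj v w} := hvw
  rw [← this] at h3
  exact h3

theorem reg_iso {V W : Type*} {U : SimpleGraph V} {H : SimpleGraph W} (e : U ≃g H)
    (hH : ∀ v, Nat.card {w // H.Adj v w} = 2) : ∀ v, Nat.card {w // U.Adj v w} = 2 := by
  intro v
  rw [← hH (e v)]
  exact Nat.card_congr (e.toEquiv.subtypeEquiv fun w => e.map_adj_iff.symm)

theorem cycZ_reg {n : ℕ} (hn : 3 ≤ n) : ∀ v, Nat.card {w // (cycZ n hn).Adj v w} = 2 := by
  intro v
  have : {w | (cycZ n hn).Adj v w} = {v + 1, v - 1} := by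
    ext w
    simp only [cycZ, Set.mem_ofPred_eq, Set.mem_insert_iff, Set.mem_singleton_iff]
    rw [eq_sub_iff_add_eq, eq_comm (a := v)]
  change {w | (cycZ n hn).Adj v w}.ncard = 2
  rw [this, Set.ncard_pair]
  intro h
  have h2 : ((2 : ℕ) : ZMod n) = 0 := by
    push_cast
    linear_combination h
  rw [ZMod.natCast_eq_zero_iff] at h2
  exact absurd (Nat.le_of_dvd (by norm_num) h2) (by omega)

theorem cycZ_iso {n : ℕ} (hn : 3 ≤ n) : Nonempty (cycZ n hn ≃g SimpleGraph.cycleGraph n) := by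
  obtain ⟨m, rfl⟩ : ∃ m, n = m + 2 := ⟨n - 2, by omega⟩
  have key : ∀ a b : Fin (m + 2),
      (SimpleGraph.cycleGraph (m + 2)).Adj a b ↔ (b = a + 1 ∨ a = b + 1) := by
    intro a b
    rw [SimpleGraph.cycleGraph_adj, sub_eq_iff_eq_add, sub_eq_iff_eq_add, add_comm 1 a,
      add_comm 1 b]
    tauto
  exact ⟨⟨Equiv.refl (Fin (m + 2)), fun {a b} => key a b⟩⟩

theorem cycZ_conn {n : ℕ} (hn : 3 ≤ n) : (cycZ n hn).Connected := by
  obtain ⟨e⟩ := cycZ_iso hn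
  rw [e.connected_iff]
  obtain ⟨m, rfl⟩ : ∃ m, n = m + 1 := ⟨n - 1, by omega⟩
  exact SimpleGraph.cycleGraph_connected

/-- The hamiltonian cycle given by a cyclic enumeration. -/
theorem ham_of_enum {V : Type*} {n : ℕ} (hn : 3 ≤ n) (G : SimpleGraph V) (e : ZMod n ≃ V)
    (h : ∀ i, G.Adj (e i) (e (i + 1))) : IsHamCycle G ((cycZ n hn).comap e.symm) := by
  have iso : (cycZ n hn).comap e.symm ≃g cycZ n hn := SimpleGraph.Iso.comap e.symm _
  refine ⟨?_, ?_, reg_iso iso (cycZ_reg hn)⟩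
  · intro x y hxy
    rcases hxy with hxy | hxy
    · have := h (e.symm x)
      rw [← hxy] at this
      simpa using this
    · have := h (e.symm y)
      rw [← hxy] at this
      simpa using this.symm
  · rw [iso.connected_iff]
    exact cycZ_conn hn

theorem enum_of_ham {V : Type*} [Fintype V] {n : ℕ} (hn : 3 ≤ n) (hcard : Fintype.card V = n)
    (C : SimpleGraph V) (hc : C.Connected) (hr : ∀ v, Nat.card {w // C.Adj v w} = 2) :
    ∃ e : ZMod n ≃ V, ∀ i, C.Adj (e i) (e (i + 1)) := by
  have : NeZero n := ⟨by omega⟩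
  have hcyc : C.IsCycles := fun v _ => hr v
  obtain ⟨v⟩ := hc.nonempty
  have hne : (C.neighborSet v).Nonempty := by
    apply Set.nonempty_of_ncard_ne_zero
    have : (C.neighborSet v).ncard = 2 := hr v
    omega
  obtain ⟨p, hp, hpv⟩ := hcyc.exists_cycle_toSubgraph_verts_eq_connectedComponentSupp
    (c := C.connectedComponentMk v) (v := v) (by simp) hne
  have hsup : ∀ w, w ∈ p.support := by
    intro w
    rw [← SimpleGraph.Walk.mem_verts_toSubgraph, hpv]
    exact SimpleGraph.ConnectedComponent.sound (hc.preconnected w v)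
  have h3 := hp.three_le_length
  have hinj : Function.Injective (fun i : Fin p.length => p.getVert i) := by
    intro i j hij
    have := hp.getVert_injOn' (show (i : ℕ) ∈ _ from by
      rw [Set.mem_ofPred_eq]; omega) (show (j : ℕ) ∈ _ from by rw [Set.mem_ofPred_eq]; omega) hij
    exact Fin.ext this
  have hsurj : Function.Surjective (fun i : Fin p.length => p.getVert i) := by
    intro w
    obtain ⟨i, hi, hil⟩ := SimpleGraph.Walk.mem_support_iff_exists_getVert.1 (hsup w)
    rcases hil.lt_or_eq with h | h
    · exact ⟨⟨i, h⟩, hi⟩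
    · refine ⟨⟨0, by omega⟩, ?_⟩
      subst h
      simp at hi
      simpa using hi
  have hlen : p.length = n := by
    have := Fintype.card_of_bijective (⟨hinj, hsurj⟩ : Function.Bijective _)
    rw [Fintype.card_fin] at this
    omega
  let f : ZMod n → V := fun i => p.getVert i.val
  have hf : Function.Bijective f := by
    constructor
    · intro i j hij
      have := @hinj ⟨i.val, by rw [hlen]; exact ZMod.val_lt i⟩ ⟨j.val, by rw [hlen]; exact ZMod.val_lt j⟩ hij
      exact ZMod.val_injective n (Fin.mk.inj this)
    · intro w
      obtain ⟨⟨i, hi⟩, h⟩ := hsurj w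
      refine ⟨(i : ZMod n), ?_⟩
      simp only [f]
      rw [ZMod.val_cast_of_lt (by omega)]
      exact h
  refine ⟨Equiv.ofBijective f hf, fun x => ?_⟩
  obtain ⟨j, hj, rfl⟩ := zrep hn x
  change C.Adj (p.getVert _) (p.getVert _)
  have hadj := p.adj_getVert_succ (i := j) (by omega)
  rw [ZMod.val_cast_of_lt hj]
  rcases Nat.lt_or_ge (j + 1) n with hj1 | hj1
  · rwa [← Nat.cast_succ, ZMod.val_cast_of_lt hj1]
  · have hjn : j + 1 = n := by omega
    rw [← Nat.cast_succ, Nat.succ_eq_add_one, hjn, ZMod.natCast_self, ZMod.val_zero]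
    rw [hjn, ← hlen, p.getVert_length] at hadj
    simpa using hadj

theorem strong_of {V : Type*} [Fintype V] {U G : SimpleGraph V} (hle : U ≤ G)
    (hP : ∀ φ : Equiv.Perm V, (∀ u v, U.Adj u v → G.Adj (φ u) (φ v)) → IsAut G φ) :
    IsStrongFixing U G := by
  classical
  have hstr : ∀ σ : Equiv.Perm V, IsAut U σ → IsAut G σ := fun σ hσ =>
    hP σ fun u v huv => hle ((hσ u v).2 huv)
  refine ⟨⟨hle, ?_⟩, hstr⟩
  have hpos : 0 < autCapCard U G := by
    have : Nonempty {σ : Equiv.Perm V // IsAut U σ ∧ IsAut G σ} :=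
      ⟨1, fun _ _ => Iff.rfl, fun _ _ => Iff.rfl⟩
    exact Nat.card_pos
  symm
  apply Nat.div_eq_of_eq_mul_left hpos
  unfold autCard sCard autCapCard
  rw [← Nat.card_prod]
  let X := {U' : SimpleGraph V // U' ≤ G ∧ Nonempty (U' ≃g U)}
  let ψ : X → Equiv.Perm V := fun x => (Classical.choice x.2.2).symm.toEquiv
  have hψ : ∀ x : X, ∀ u v, x.1.Adj (ψ x u) (ψ x v) ↔ U.Adj u v := fun x u v =>
    (Classical.choice x.2.2).symm.map_adj_iff
  have hψG : ∀ x : X, IsAut G (ψ x) := fun x =>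
    hP _ fun u v huv => x.2.1 ((hψ x u v).2 huv)
  symm
  let F : X × {σ : Equiv.Perm V // IsAut U σ ∧ IsAut G σ} → {σ : Equiv.Perm V // IsAut G σ} :=
    fun q => ⟨q.2.1.trans (ψ q.1), fun u v => (hψG q.1 _ _).trans (q.2.2.2 u v)⟩
  refine Nat.card_congr (Equiv.ofBijective F ⟨?_, ?_⟩)
  · rintro ⟨x, σ, hσ⟩ ⟨y, τ, hτ⟩ h
    have h' : ∀ u, ψ x (σ u) = ψ y (τ u) := fun u =>
      congrArg (fun q : {σ : Equiv.Perm V // IsAut G σ} => q.1 u) h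
    have hxy : x = y := by
      apply Subtype.ext
      ext a b
      obtain ⟨a, rfl⟩ := (σ.trans (ψ x)).surjective a
      obtain ⟨b, rfl⟩ := (σ.trans (ψ x)).surjective b
      simp only [Equiv.trans_apply]
      rw [hψ, hσ.1, h', h', hψ, hτ.1]
    subst hxy
    have : σ = τ := Equiv.ext fun u => (ψ x).injective (h' u)
    subst this
    rfl
  · rintro ⟨φ, hφ⟩
    let U' : SimpleGraph V := U.comap φ.symm
    have hU' : ∀ u v, U'.Adj (φ u) (φ v) ↔ U.Adj u v := by
      intro u v; simp [U']
    let x : X := ⟨U', by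
      intro a b hab
      obtain ⟨a, rfl⟩ := φ.surjective a
      obtain ⟨b, rfl⟩ := φ.surjective b
      exact (hφ a b).2 (hle ((hU' a b).1 hab)), ⟨SimpleGraph.Iso.comap φ.symm U⟩⟩
    have hσ : IsAut U (φ.trans (ψ x).symm) := by
      intro u v
      rw [← hψ x]
      simpa using hU' u v
    refine ⟨(x, ⟨φ.trans (ψ x).symm, hσ, hstr _ hσ⟩), ?_⟩
    apply Subtype.ext
    ext u
    simp [F]

/-- Graph on `ZMod n` joining elements of different parity. -/
def parZ (n : ℕ) : SimpleGraph (ZMod n) where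
  Adj i j := i.val % 2 ≠ j.val % 2
  symm := ⟨fun i j h => h.symm⟩
  loopless := ⟨fun i h => h rfl⟩

theorem parZ_iso {n : ℕ} (hn : 3 ≤ n) (he : Even n) :
    Nonempty (parZ n ≃g completeBipartiteGraph (Fin (n / 2)) (Fin (n / 2))) := by
  have : NeZero n := ⟨by omega⟩
  have he' := Nat.even_iff.1 he
  let f : Fin (n / 2) ⊕ Fin (n / 2) → ZMod n :=
    Sum.elim (fun i => ((2 * i.val : ℕ) : ZMod n)) (fun i => ((2 * i.val + 1 : ℕ) : ZMod n))
  have hl : ∀ i, (f (Sum.inl i)).val = 2 * i.val := fun i => ZMod.val_cast_of_lt (by omega)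
  have hr : ∀ i, (f (Sum.inr i)).val = 2 * i.val + 1 := fun i => ZMod.val_cast_of_lt (by omega)
  have hf : Function.Bijective f := by
    constructor
    · intro a b hab
      have hab := congrArg ZMod.val hab
      rcases a with a | a <;> rcases b with b | b <;> simp only [hl, hr] at hab
      · congr 1; exact Fin.ext (by omega)
      · omega
      · omega
      · congr 1; exact Fin.ext (by omega)
    · intro x
      obtain ⟨j, hj, rfl⟩ := zrep hn x
      rcases Nat.mod_two_eq_zero_or_one j with h | h
      · refine ⟨Sum.inl ⟨j / 2, by omega⟩, ?_⟩
        simp only [f, Sum.elim_inl]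
        congr 1; omega
      · refine ⟨Sum.inr ⟨j / 2, by omega⟩, ?_⟩
        simp only [f, Sum.elim_inr]
        congr 1; omega
  refine ⟨SimpleGraph.Iso.symm ⟨Equiv.ofBijective f hf, ?_⟩⟩
  intro a b
  change (f a).val % 2 ≠ (f b).val % 2 ↔ _
  rcases a with a | a <;> rcases b with b | b <;> simp only [hl, hr] <;> simp <;> omega

theorem bip_fix {V : Type*} {U G : SimpleGraph V} (c : V → Prop)
    (hG : ∀ u v, G.Adj u v ↔ ¬ (c u ↔ c v)) (hle : U ≤ G) (hc : U.Connected)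
    (φ : Equiv.Perm V) (hφ : ∀ u v, U.Adj u v → G.Adj (φ u) (φ v)) : IsAut G φ := by
  have key : ∀ u v, U.Reachable u v → ((c u ↔ c (φ u)) ↔ (c v ↔ c (φ v))) := by
    rintro u v ⟨p⟩
    induction p with
    | nil => exact Iff.rfl
    | cons h p ih =>
      rw [← ih]
      have h1 := (hG _ _).1 (hle h)
      have h2 := (hG _ _).1 (hφ _ _ h)
      tauto
  intro u v
  rw [hG, hG]
  have := key u v (hc.preconnected u v)
  tauto

theorem inFstarHAM_iff {V : Type*} [Fintype V] (n : ℕ) (hn : 3 ≤ n)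
    (hcard : Fintype.card V = n) (G : SimpleGraph V) :
    InFstarHAM G ↔
      Nonempty (G ≃g SimpleGraph.cycleGraph n) ∨
      Nonempty (G ≃g (⊤ : SimpleGraph (Fin n))) ∨
      (Even n ∧ Nonempty (G ≃g completeBipartiteGraph (Fin (n / 2)) (Fin (n / 2)))) := by
  have : NeZero n := ⟨by omega⟩
  constructor
  · rintro ⟨⟨C, hCG, hCc, hCr⟩, hall⟩
    obtain ⟨e, he⟩ := enum_of_ham hn hcard C hCc hCr
    have heG : ∀ i, G.Adj (e i) (e (i + 1)) := fun i => hCG (he i)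
    have hrot : ∀ e : ZMod n ≃ V, (∀ i, G.Adj (e i) (e (i + 1))) → ∀ i j,
        G.Adj (e i) (e j) ↔ G.Adj (e (i + 1)) (e (j + 1)) := by
      intro e he i j
      have h := (hall _ (ham_of_enum hn G e he)).2
        ((e.symm.trans (Equiv.addRight 1)).trans e) (by
          intro u v
          simp [cycZ])
      have := h (e i) (e j)
      simpa using this.symm
    have iso : G.comap e ≃g G := SimpleGraph.Iso.comap e G
    rcases core_adj hn (G.comap e) heG (fun π hπ i j => hrot (π.trans e) hπ i j) with h | h | ⟨hev, h⟩
    · left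
      obtain ⟨f⟩ := cycZ_iso hn
      have : G.comap e = cycZ n hn := by ext i j; exact h i j
      rw [this] at iso
      exact ⟨iso.symm.trans f⟩
    · right; left
      have : G.comap e = ⊤ := by
        ext i j
        exact ⟨fun h => h.ne, fun hij => h i j hij⟩
      rw [this] at iso
      exact ⟨iso.symm.trans (SimpleGraph.Iso.completeGraph
        (Fintype.equivOfCardEq (by rw [ZMod.card, Fintype.card_fin])))⟩
    · right; right
      obtain ⟨f⟩ := parZ_iso hn hev
      have : G.comap e = parZ n := by ext i j; exact h i j
      rw [this] at iso
      exact ⟨hev, ⟨iso.symm.trans f⟩⟩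
  · rintro (⟨⟨f⟩⟩ | ⟨⟨f⟩⟩ | ⟨hev, ⟨f⟩⟩)
    · obtain ⟨g⟩ := cycZ_iso hn
      have k : G ≃g cycZ n hn := f.trans g.symm
      have hreg := reg_iso k (cycZ_reg hn)
      refine ⟨⟨G, le_rfl, k.connected_iff.2 (cycZ_conn hn), hreg⟩, ?_⟩
      rintro C ⟨hle, -, hr⟩
      have hCG := reg_eq hle hr hreg
      subst hCG
      refine strong_of le_rfl fun φ hφ => ?_
      have := reg_eq (U := C) (H := C.comap φ) (fun u v h => hφ u v h) hr
        (reg_iso (SimpleGraph.Iso.comap φ C) hr)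
      intro u v
      conv_rhs => rw [this]
      rfl
    · have hG : ∀ u v, G.Adj u v ↔ u ≠ v := by
        intro u v
        rw [← f.map_adj_iff]
        simp
      refine ⟨⟨_, ham_of_enum hn G
        (Fintype.equivOfCardEq (by rw [ZMod.card, hcard])) ?_⟩, ?_⟩
      · intro i
        rw [hG, (Equiv.injective _).ne_iff]
        exact ((cycZ n hn).ne_of_adj (Or.inl rfl))
      · rintro C ⟨hle, -, -⟩
        refine strong_of hle fun φ _ u v => ?_
        rw [hG, hG, φ.injective.ne_iff]
    · obtain ⟨g⟩ := parZ_iso hn hev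
      have k : G ≃g parZ n := f.trans g.symm
      have hG : ∀ u v, G.Adj u v ↔ (k u).val % 2 ≠ (k v).val % 2 := fun u v =>
        k.map_adj_iff.symm
      refine ⟨⟨_, ham_of_enum hn G k.symm.toEquiv ?_⟩, ?_⟩
      · intro i
        refine (SimpleGraph.Iso.map_adj_iff (SimpleGraph.Iso.symm k) (v := i) (w := i + 1)).2 ?_
        change i.val % 2 ≠ (i + 1).val % 2
        have : Fact (1 < n) := ⟨by omega⟩
        rw [ZMod.val_add, ZMod.val_one, Nat.mod_mod_of_dvd _ hev.two_dvd]
        omega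
      · rintro C ⟨hle, hc, -⟩
        refine strong_of hle fun φ hφ => ?_
        refine bip_fix (fun v => (k v).val % 2 = 0) (fun u v => ?_) hle hc φ hφ
        rw [hG]
        omega
end

section
/- Let G be a finite simple graph on n ≥ 3 vertices which is hamiltonian and such that for every hamiltonian cycle C ≤ G, every automorphism of C is an automorphism of G. Then G is isomorphic to the cycle graph C_n, or to the complete graph K_n, or (when n is even) to the complete bipartite graph K_{n/2,n/2}. -/
/-- A hamiltonian cycle yields a cyclic enumeration of the vertices. -/
lemma aux_enum {V : Type*} [Fintype V] (m : ℕ) (hcard : Fintype.card V = m + 3)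
    (G C : SimpleGraph V) (h : IsHamCycle G C) :
    ∃ f : Fin (m + 3) ≃ V, ∀ i j, (SimpleGraph.cycleGraph (m + 3)).Adj i j → G.Adj (f i) (f j) := by
  classical
  obtain ⟨hle, hconn, hdeg⟩ := h
  have hcyc : C.IsCycles := by
    intro v _
    have := hdeg v
    rw [Set.ncard_eq_toFinset_card', ← Nat.card_eq_card_toFinset]
    exact this
  obtain ⟨v⟩ := hconn.nonempty
  have hne : (C.neighborSet v).Nonempty := by
    by_contra hcon
    rw [Set.not_nonempty_iff_eq_empty] at hcon
    have h2 := hdeg v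
    have : IsEmpty {w // C.Adj v w} := ⟨fun w => by
      have : w.1 ∈ C.neighborSet v := w.2
      rw [hcon] at this; exact this⟩
    rw [Nat.card_of_isEmpty] at h2
    omega
  obtain ⟨p, hp, hverts⟩ := hcyc.exists_cycle_toSubgraph_verts_eq_connectedComponentSupp
    (c := C.connectedComponentMk v) (v := v) rfl hne
  have hmem : ∀ w, w ∈ p.support := by
    intro w
    rw [← p.mem_verts_toSubgraph, hverts]
    simpa [SimpleGraph.ConnectedComponent.mem_supp_iff] using hconn.preconnected w v
  have hH : p.IsHamiltonianCycle := by
    rw [SimpleGraph.Walk.isHamiltonianCycle_iff_isCycle_and_support_count_tail_eq_one]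
    refine ⟨hp, fun a => ?_⟩
    apply List.count_eq_one_of_mem hp.support_nodup
    have := hmem a
    rw [SimpleGraph.Walk.mem_support_iff] at this
    rcases this with rfl | h
    · exact SimpleGraph.Walk.end_mem_tail_support hp.not_nil
    · exact h
  have hlen := hH.length_eq
  obtain ⟨φ⟩ := (SimpleGraph.cycleGraph_isContained_iff (G := C) (n := m + 3) (by omega)).2
    ⟨v, p, hp, by omega⟩
  have hb : Function.Bijective φ := by
    rw [Fintype.bijective_iff_injective_and_card]
    exact ⟨φ.injective, by simp [hcard]⟩
  exact ⟨Equiv.ofBijective φ hb, fun i j hij => hle (φ.toHom.map_adj hij)⟩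

/-- Every cyclic enumeration along edges makes `G` circulant. -/
lemma aux_circ {V : Type*} (m : ℕ) (G : SimpleGraph V)
    (hext : ∀ C, IsHamCycle G C → ∀ σ : Equiv.Perm V, IsAut C σ → IsAut G σ)
    (f : Fin (m + 3) ≃ V)
    (hf : ∀ i j, (SimpleGraph.cycleGraph (m + 3)).Adj i j → G.Adj (f i) (f j))
    (i j t : Fin (m + 3)) : G.Adj (f (i + t)) (f (j + t)) ↔ G.Adj (f i) (f j) := by
  let C : SimpleGraph V := (SimpleGraph.cycleGraph (m + 3)).comap f.symm
  let e : C ≃g SimpleGraph.cycleGraph (m + 3) := SimpleGraph.Iso.comap f.symm _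
  have hC : IsHamCycle G C := by
    refine ⟨?_, ?_, ?_⟩
    · intro u v huv
      have := hf _ _ (show (SimpleGraph.cycleGraph (m + 3)).Adj (f.symm u) (f.symm v) from huv)
      simpa using this
    · exact e.connected_iff.2 SimpleGraph.cycleGraph_connected
    · intro v
      have h1 : {w // C.Adj v w} ≃ (SimpleGraph.cycleGraph (m + 3)).neighborSet (f.symm v) :=
        e.mapNeighborSet v
      rw [Nat.card_congr h1, Nat.card_eq_fintype_card, SimpleGraph.card_neighborSet_eq_degree,
        SimpleGraph.cycleGraph_degree_three_le]
  have := hext C hC (f.symm.trans ((Equiv.addRight t).trans f)) (by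
    intro u v
    simp [C, SimpleGraph.comap_adj, SimpleGraph.cycleGraph_adj]) (f i) (f j)
  simpa using this

/-- Difference predicate of a circulant enumeration. -/
lemma aux_diff {V : Type*} (m : ℕ) (G : SimpleGraph V)
    (hext : ∀ C, IsHamCycle G C → ∀ σ : Equiv.Perm V, IsAut C σ → IsAut G σ)
    (f : Fin (m + 3) ≃ V)
    (hf : ∀ i j, (SimpleGraph.cycleGraph (m + 3)).Adj i j → G.Adj (f i) (f j)) :
    ∃ P : ℕ → Prop, (∀ i j : Fin (m + 3), i < j → (G.Adj (f i) (f j) ↔ P (j.val - i.val))) ∧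
      (∀ d, 0 < d → d < m + 3 → (P d ↔ P (m + 3 - d))) ∧ P 1 := by
  have hc := aux_circ m G hext f hf
  have h1 : ∀ i j : Fin (m + 3), i < j →
      (G.Adj (f i) (f j) ↔ G.Adj (f 0) (f (Fin.ofNat (m + 3) (j.val - i.val)))) := by
    intro i j hij
    rw [← hc 0 _ i]
    have : Fin.ofNat (m + 3) (j.val - i.val) + i = j := by
      apply Fin.ext
      have := j.2
      have := i.2
      rw [Fin.lt_def] at hij
      simp only [Fin.val_add, Fin.val_ofNat]
      rw [Nat.mod_eq_of_lt (a := j.val - i.val) (by omega),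
        Nat.sub_add_cancel hij.le, Nat.mod_eq_of_lt j.2]
    rw [this, zero_add]
  refine ⟨fun d => G.Adj (f 0) (f (Fin.ofNat (m + 3) d)), h1, ?_, ?_⟩
  · intro d h0 hd
    show _ ↔ G.Adj _ _
    rw [← hc 0 (Fin.ofNat (m + 3) (m + 3 - d)) (Fin.ofNat (m + 3) d), zero_add]
    have : Fin.ofNat (m + 3) (m + 3 - d) + Fin.ofNat (m + 3) d = 0 := by
      apply Fin.ext
      simp only [Fin.val_add, Fin.val_ofNat]
      rw [Nat.mod_eq_of_lt (a := m + 3 - d) (by omega), Nat.mod_eq_of_lt hd,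
        Nat.sub_add_cancel hd.le]
      simp
    rw [this, G.adj_comm]
  · apply hf
    rw [SimpleGraph.cycleGraph_adj]
    right
    simp
    rfl

/-- Reversal of the first `k` positions. -/
def aux_rev (n k : ℕ) (hk : k < n) : Equiv.Perm (Fin n) :=
  Function.Involutive.toPerm
    (fun i => if h : i.val < k then ⟨k - 1 - i.val, by omega⟩ else i)
    (by
      intro i
      by_cases h : i.val < k
      · have : k - 1 - i.val < k := by omega
        simp only [h, this, dif_pos]
        apply Fin.ext
        simp only []
        omega
      · simp [h])

lemma aux_rev_lt (n k : ℕ) (hk : k < n) (i : Fin n) (h : i.val < k) :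
    (aux_rev n k hk i).val = k - 1 - i.val := by
  change (if h : i.val < k then (⟨k - 1 - i.val, by omega⟩ : Fin n) else i).val = _
  simp [h]

lemma aux_rev_ge (n k : ℕ) (hk : k < n) (i : Fin n) (h : k ≤ i.val) :
    (aux_rev n k hk i).val = i.val := by
  have : ¬ i.val < k := by omega
  change (if h : i.val < k then (⟨k - 1 - i.val, by omega⟩ : Fin n) else i).val = _
  simp [this]

/-- Adjacency in the cycle graph in terms of natural numbers. -/
lemma aux_cyc (m : ℕ) (i j : Fin (m + 3)) (hij : i < j) :
    (SimpleGraph.cycleGraph (m + 3)).Adj i j ↔ j.val = i.val + 1 ∨ (i.val = 0 ∧ j.val = m + 2) := by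
  rw [SimpleGraph.cycleGraph_adj']
  have hi := i.2
  have hj := j.2
  rw [Fin.sub_val_of_le hij.le, Fin.coe_sub_iff_lt.2 hij]
  rw [Fin.lt_def] at hij
  omega

/-- The combinatorial heart: a chord forces parity-periodicity. -/
lemma aux_step {V : Type*} (m : ℕ) (G : SimpleGraph V)
    (hext : ∀ C, IsHamCycle G C → ∀ σ : Equiv.Perm V, IsAut C σ → IsAut G σ)
    (f : Fin (m + 3) ≃ V) (P : ℕ → Prop)
    (hP : ∀ i j : Fin (m + 3), i < j → (G.Adj (f i) (f j) ↔ P (j.val - i.val)))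
    (hsym : ∀ d, 0 < d → d < m + 3 → (P d ↔ P (m + 3 - d))) (hP1 : P 1)
    (k : ℕ) (hk2 : 2 ≤ k) (hkn : 2 * k ≤ m + 3) (hPk : P k) :
    ∀ d, 1 ≤ d → d ≤ m → (P d ↔ P (d + 2)) := by
  have hk : k < m + 3 := by omega
  obtain ⟨y, ylt, yge⟩ : ∃ y : Equiv.Perm (Fin (m + 3)),
      (∀ i, i.val < k → (y i).val = k - 1 - i.val) ∧ (∀ i, k ≤ i.val → (y i).val = i.val) :=
    ⟨aux_rev (m + 3) k hk, aux_rev_lt _ _ hk, aux_rev_ge _ _ hk⟩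
  have hlow : ∀ i j : Fin (m + 3), i.val < k → k ≤ j.val →
      (G.Adj (f (y i)) (f (y j)) ↔ P (j.val - (k - 1 - i.val))) := by
    intro i j hi hj
    have e1 := ylt i hi
    have e2 := yge j hj
    rw [hP _ _ (by rw [Fin.lt_def]; omega), e1, e2]
  have hhigh : ∀ i j : Fin (m + 3), k ≤ i.val → i < j →
      (G.Adj (f (y i)) (f (y j)) ↔ P (j.val - i.val)) := by
    intro i j hi hij
    rw [Fin.lt_def] at hij
    have e1 := yge i hi
    have e2 := yge j (by omega)
    rw [hP _ _ (by rw [Fin.lt_def]; omega), e1, e2]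
  have hy : ∀ i j, (SimpleGraph.cycleGraph (m + 3)).Adj i j →
      G.Adj ((y.trans f) i) ((y.trans f) j) := by
    have key : ∀ i j : Fin (m + 3), i < j → (SimpleGraph.cycleGraph (m + 3)).Adj i j →
        G.Adj (f (y i)) (f (y j)) := by
      intro i j hij hadj
      rw [aux_cyc m i j hij] at hadj
      have hj := j.2
      by_cases h1 : k ≤ i.val
      · rw [hhigh i j h1 hij]
        have : j.val - i.val = 1 := by omega
        rwa [this]
      · by_cases h2 : k ≤ j.val
        · rw [hlow i j (by omega) h2]
          rcases hadj with h | ⟨h, h'⟩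
          · have : j.val - (k - 1 - i.val) = k := by omega
            rwa [this]
          · have : j.val - (k - 1 - i.val) = m + 3 - k := by omega
            rw [this]
            exact (hsym k (by omega) hk).1 hPk
        · have e1 := ylt i (by omega)
          have e2 := ylt j (by omega)
          rw [Fin.lt_def] at hij
          rw [G.adj_comm, hP _ _ (by rw [Fin.lt_def]; omega), e1, e2]
          have : (k - 1 - i.val) - (k - 1 - j.val) = 1 := by omega
          rwa [this]
    intro i j hadj
    rcases lt_trichotomy i j with h | h | h
    · exact key i j h hadj
    · subst h; exact absurd hadj (SimpleGraph.irrefl _)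
    · exact (key j i h hadj.symm).symm
  obtain ⟨Q, hQ, hQsym, hQ1⟩ := aux_diff m G hext (y.trans f) hy
  have hQ' : ∀ i j : Fin (m + 3), i < j → (G.Adj (f (y i)) (f (y j)) ↔ Q (j.val - i.val)) := hQ
  -- Q agrees with P on short distances
  have hA : ∀ d, 1 ≤ d → d + k ≤ m + 2 → (Q d ↔ P d) := by
    intro d h1 h2
    have a := hQ' ⟨k, hk⟩ ⟨k + d, by omega⟩ (by rw [Fin.lt_def]; simp; omega)
    have b := hhigh ⟨k, hk⟩ ⟨k + d, by omega⟩ le_rfl (by rw [Fin.lt_def]; simp; omega)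
    simp only [Nat.add_sub_cancel_left] at a b
    rw [← a, b]
  have hB : ∀ i j : ℕ, i < k → k ≤ j → j < m + 3 → (Q (j - i) ↔ P (j - (k - 1 - i))) := by
    intro i j hi hj hj'
    rw [← hQ' ⟨i, by omega⟩ ⟨j, hj'⟩ (by rw [Fin.lt_def]; simp; omega),
      hlow ⟨i, by omega⟩ ⟨j, hj'⟩ hi hj]
  have hQP : ∀ d, 1 ≤ d → d ≤ m + 2 → (Q d ↔ P d) := by
    intro d h1 h2
    by_cases h3 : d + k ≤ m + 2
    · exact hA d h1 h3
    by_cases h4 : k + 1 ≤ d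
    · rw [hQsym d (by omega) (by omega), hsym d (by omega) (by omega)]
      exact hA _ (by omega) (by omega)
    · have : d = k := by omega
      subst this
      have := hB 0 d (by omega) le_rfl hk
      have e : d - (d - 1 - 0) = 1 := by omega
      rw [e, Nat.sub_zero] at this
      exact ⟨fun _ => hPk, fun _ => this.2 hP1⟩
  have hC : ∀ i j : ℕ, i < k → k ≤ j → j < m + 3 → (P (j - i) ↔ P (j - (k - 1 - i))) := by
    intro i j hi hj hj'
    rw [← hB i j hi hj hj', hQP _ (by omega) (by omega)]
  have hD : ∀ d, 1 ≤ d → d + k ≤ m + 2 → (P d ↔ P (d + 2)) := by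
    intro d h1 h2
    have a := hC (k - 1) (d + k - 1) (by omega) (by omega) (by omega)
    have b := hC (k - 2) (d + k) (by omega) (by omega) (by omega)
    have e1 : d + k - 1 - (k - 1) = d := by omega
    have e2 : d + k - 1 - (k - 1 - (k - 1)) = d + k - 1 := by omega
    have e3 : d + k - (k - 2) = d + 2 := by omega
    have e4 : d + k - (k - 1 - (k - 2)) = d + k - 1 := by omega
    rw [e1, e2] at a
    rw [e3, e4] at b
    rw [a, b]
  intro d h1 h2
  by_cases h : d + k ≤ m + 2
  · exact hD d h1 h
  · have := hD (m + 3 - (d + 2)) (by omega) (by omega)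
    rw [hsym d (by omega) (by omega), hsym (d + 2) (by omega) (by omega), this]
    have e : m + 3 - (d + 2) + 2 = m + 3 - d := by omega
    rw [e]

lemma aux_par (m : ℕ) (P : ℕ → Prop) (h : ∀ d, 1 ≤ d → d ≤ m → (P d ↔ P (d + 2)))
    (a s : ℕ) (ha : 1 ≤ a) (hs : a + 2 * s ≤ m + 2) : P (a + 2 * s) ↔ P a := by
  induction s with
  | zero => simp
  | succ s ih =>
    rw [← ih (by omega), h (a + 2 * s) (by omega) (by omega)]
    rfl

/-- Splitting `Fin (2 * q)` into even and odd positions. -/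
def aux_split (q : ℕ) : Fin (2 * q) ≃ Fin q ⊕ Fin q where
  toFun i := if i.val % 2 = 0 then Sum.inl ⟨i.val / 2, by omega⟩ else Sum.inr ⟨i.val / 2, by omega⟩
  invFun := Sum.elim (fun i => ⟨2 * i.val, by omega⟩) (fun i => ⟨2 * i.val + 1, by omega⟩)
  left_inv i := by
    by_cases h : i.val % 2 = 0
    · simp only [h, if_true, Sum.elim_inl]
      apply Fin.ext; simp only []; omega
    · simp only [h, if_false, Sum.elim_inr]
      apply Fin.ext; simp only []; omega
  right_inv i := by
    rcases i with i | i
    · simp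
    · have : (2 * i.val + 1) % 2 ≠ 0 := by omega
      simp only [Sum.elim_inr, this, if_false]
      congr 1; apply Fin.ext; simp only []; omega

lemma aux_split_adj (q : ℕ) (i j : Fin (2 * q)) :
    (completeBipartiteGraph (Fin q) (Fin q)).Adj (aux_split q i) (aux_split q j) ↔
      i.val % 2 ≠ j.val % 2 := by
  have hi : i.val % 2 = 0 ∨ i.val % 2 = 1 := by omega
  have hj : j.val % 2 = 0 ∨ j.val % 2 = 1 := by omega
  rcases hi with h | h <;> rcases hj with h' | h' <;>
    simp [aux_split, h, h', completeBipartiteGraph]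

/-- Reduce an isomorphism to ordered pairs of indices. -/
lemma aux_iso {V W : Type*} (n : ℕ) (G : SimpleGraph V) (H : SimpleGraph W) (f : Fin n ≃ V)
    (g : Fin n ≃ W) (h : ∀ i j : Fin n, i < j → (G.Adj (f i) (f j) ↔ H.Adj (g i) (g j))) :
    Nonempty (G ≃g H) := by
  refine ⟨⟨f.symm.trans g, ?_⟩⟩
  intro u v
  obtain ⟨i, rfl⟩ := f.surjective u
  obtain ⟨j, rfl⟩ := f.surjective v
  simp only [Equiv.trans_apply, Equiv.symm_apply_apply]
  rcases lt_trichotomy i j with hij | hij | hij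
  · exact (h i j hij).symm
  · subst hij; simp
  · rw [H.adj_comm, G.adj_comm]; exact (h j i hij).symm

/-- **Theorem 6 (strengthened form).** If `G` is hamiltonian on `n ≥ 3` vertices and
for every hamiltonian cycle `C ≤ G` every automorphism of `C` is an automorphism of `G`,
then `G ≅ Cₙ`, `G ≅ Kₙ`, or (for even `n`) `G ≅ K_{n/2,n/2}`. -/
theorem hamCycle_aut_extends {V : Type*} [Fintype V] (n : ℕ) (hn : 3 ≤ n)
    (hcard : Fintype.card V = n) (G : SimpleGraph V)
    (hham : ∃ C, IsHamCycle G C)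
    (hext : ∀ C, IsHamCycle G C → ∀ σ : Equiv.Perm V, IsAut C σ → IsAut G σ) :
    Nonempty (G ≃g SimpleGraph.cycleGraph n) ∨
    Nonempty (G ≃g (⊤ : SimpleGraph (Fin n))) ∨
    (Even n ∧ Nonempty (G ≃g completeBipartiteGraph (Fin (n / 2)) (Fin (n / 2)))) := by
  obtain ⟨m, rfl⟩ : ∃ m, n = m + 3 := ⟨n - 3, by omega⟩
  obtain ⟨C, hC⟩ := hham
  obtain ⟨f, hf⟩ := aux_enum m hcard G C hC
  obtain ⟨P, hP, hsym, hP1⟩ := aux_diff m G hext f hf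
  by_cases hch : ∃ k, 2 ≤ k ∧ k ≤ m + 1 ∧ P k
  · have hstep : ∀ d, 1 ≤ d → d ≤ m → (P d ↔ P (d + 2)) := by
      obtain ⟨k, h2, hk, hPk⟩ := hch
      by_cases h : 2 * k ≤ m + 3
      · exact aux_step m G hext f P hP hsym hP1 k h2 h hPk
      · exact aux_step m G hext f P hP hsym hP1 (m + 3 - k) (by omega) (by omega)
          ((hsym k (by omega) (by omega)).1 hPk)
    have hpar := aux_par m P hstep
    have hodd : ∀ d, d ≤ m + 2 → d % 2 = 1 → P d := by
      intro d hd h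
      have := hpar 1 (d / 2) le_rfl (by omega)
      rw [show 1 + 2 * (d / 2) = d by omega] at this
      exact this.2 hP1
    have heven : ∀ d, 2 ≤ d → d ≤ m + 2 → d % 2 = 0 → (P d ↔ P 2) := by
      intro d h2 hd h
      have := hpar 2 (d / 2 - 1) (by omega) (by omega)
      rwa [show 2 + 2 * (d / 2 - 1) = d by omega] at this
    by_cases h2 : P 2
    · right; left
      apply aux_iso _ _ _ f (Equiv.refl _)
      intro i j hij
      rw [hP i j hij]
      have hj := j.2
      have hne : i ≠ j := hij.ne
      rw [Fin.lt_def] at hij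
      simp only [Equiv.refl_apply, SimpleGraph.top_adj, ne_eq, hne, not_false_eq_true, iff_true]
      rcases Nat.mod_two_eq_zero_or_one (j.val - i.val) with h | h
      · exact (heven _ (by omega) (by omega) h).2 h2
      · exact hodd _ (by omega) h
    · right; right
      have hev : (m + 3) % 2 = 0 := by
        by_contra hcon
        apply h2
        rw [← heven (m + 2) (by omega) le_rfl (by omega)]
        have := (hsym 1 (by omega) (by omega)).1 hP1
        exact this
      refine ⟨Nat.even_iff.2 hev, ?_⟩
      have e : m + 3 = 2 * ((m + 3) / 2) := by omega
      apply aux_iso _ _ _ f ((finCongr e).trans (aux_split _))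
      intro i j hij
      rw [hP i j hij]
      simp only [Equiv.trans_apply]
      rw [aux_split_adj]
      simp only [finCongr_apply, Fin.val_cast]
      have hj := j.2
      rw [Fin.lt_def] at hij
      rcases Nat.mod_two_eq_zero_or_one (j.val - i.val) with h | h
      · rw [heven _ (by omega) (by omega) h]
        exact ⟨fun h => absurd h h2, fun h => by omega⟩
      · exact ⟨fun _ => by omega, fun _ => hodd _ (by omega) h⟩
  · left
    apply aux_iso _ _ _ f (Equiv.refl _)
    intro i j hij
    refine ⟨fun h => ?_, fun h => hf i j h⟩
    rw [hP i j hij] at h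
    simp only [Equiv.refl_apply]
    rw [aux_cyc m i j hij]
    have hj := j.2
    rw [Fin.lt_def] at hij
    by_contra hcon
    exact hch ⟨j.val - i.val, by omega, by omega, h⟩
end

section
/- Let n ≥ 3. The generalized Petersen graph G(n,1) (the n-prism) belongs to F(HAM) (i.e., G(n,1) is hamiltonian and every hamiltonian cycle of G(n,1) is a fixing subgraph) if and only if n is odd or n = 4. -/
section helpers

theorem hp_two {V : Type*} (S : Set V) (x y z : V) (hxy : x ≠ y) (hxz : x ≠ z) (hyz : y ≠ z)
    (hS : ∀ w ∈ S, w = x ∨ w = y ∨ w = z) (h2 : S.ncard = 2) :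
    (x ∈ S ∧ y ∈ S ∧ z ∉ S) ∨ (x ∈ S ∧ y ∉ S ∧ z ∈ S) ∨ (x ∉ S ∧ y ∈ S ∧ z ∈ S) := by
  obtain ⟨p, q, hpq, rfl⟩ := Set.ncard_eq_two.1 h2
  have hp := hS p (by simp)
  have hq := hS q (by simp)
  simp only [Set.mem_insert_iff, Set.mem_singleton_iff]
  grind

theorem hp_closed {V : Type*} (C : SimpleGraph V) (hC : C.Connected) (S : V → Prop)
    (hS : ∀ u v, C.Adj u v → S u → S v) (u v : V) (hu : S u) : S v := by
  obtain ⟨w⟩ := hC.preconnected u v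
  induction w with
  | nil => exact hu
  | cons h _ ih => exact ih (hS _ _ h hu)

/-- automorphism subgroup -/
def hpAut {V : Type*} (G : SimpleGraph V) : Subgroup (Equiv.Perm V) where
  carrier := {σ | IsAut G σ}
  mul_mem' := by
    intro a b ha hb u v
    simp only [Equiv.Perm.mul_apply]
    rw [ha, hb]
  one_mem' := by intro u v; rfl
  inv_mem' := by
    intro a ha u v
    rw [← ha]
    simp

/-- action on graphs -/
@[reducible] def hpAct {V : Type*} (G : SimpleGraph V) : MulAction (hpAut G) (SimpleGraph V) where
  smul σ U := U.comap (σ⁻¹ : hpAut G).1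
  one_smul U := by
    ext u v
    change U.Adj _ _ ↔ _
    simp
  mul_smul σ τ U := by
    ext u v
    change U.Adj _ _ ↔ U.Adj _ _
    simp

theorem hp_fixing {V : Type*} [Finite V] (G U : SimpleGraph V) (hU : U ≤ G) :
    IsFixing U G ↔ ∀ U' : SimpleGraph V, U' ≤ G → Nonempty (U' ≃g U) →
      ∃ σ : Equiv.Perm V, IsAut G σ ∧ ∀ u v, U'.Adj (σ u) (σ v) ↔ U.Adj u v := by
  classical
  let := hpAct G
  have smul_adj : ∀ (σ : hpAut G) (X : SimpleGraph V) (u v : V),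
      (σ • X).Adj u v ↔ X.Adj (σ.1⁻¹ u) (σ.1⁻¹ v) := fun σ X u v => Iff.rfl
  have smul_iff : ∀ (σ : hpAut G) (X Y : SimpleGraph V),
      σ • X = Y ↔ ∀ u v, Y.Adj (σ.1 u) (σ.1 v) ↔ X.Adj u v := by
    intro σ X Y
    constructor
    · rintro rfl u v
      rw [smul_adj]; simp
    · intro h
      ext u v
      rw [smul_adj, ← h]; simp
  have h1 : autCard G = Nat.card (hpAut G) := rfl
  have h2 : autCapCard U G = Nat.card (MulAction.stabilizer (hpAut G) U) := by
    unfold autCapCard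
    refine Nat.card_congr ⟨fun σ => ⟨⟨σ.1, σ.2.2⟩, ?_⟩, fun σ => ⟨σ.1.1, ?_, σ.1.2⟩, ?_, ?_⟩
    · rw [MulAction.mem_stabilizer_iff, smul_iff]; exact σ.2.1
    · have := σ.2
      rw [MulAction.mem_stabilizer_iff, smul_iff] at this; exact this
    · intro x; rfl
    · intro x; rfl
  have h3 : autCard G / autCapCard U G = (MulAction.orbit (hpAut G) U).ncard := by
    rw [← MulAction.index_stabilizer, h1, h2]
    rw [← Subgroup.card_mul_index (MulAction.stabilizer (hpAut G) U)]
    exact Nat.mul_div_cancel_left _ Nat.card_pos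
  have h4 : sCard U G = {U' : SimpleGraph V | U' ≤ G ∧ Nonempty (U' ≃g U)}.ncard := rfl
  have hsub : MulAction.orbit (hpAut G) U ⊆ {U' : SimpleGraph V | U' ≤ G ∧ Nonempty (U' ≃g U)} := by
    rintro U' ⟨σ, hσ⟩
    have hσ' := (smul_iff σ U U').1 hσ
    refine ⟨?_, ⟨(SimpleGraph.Iso.symm ⟨σ.1, ?_⟩)⟩⟩
    · intro u v huv
      have := (hσ' (σ.1⁻¹ u) (σ.1⁻¹ v)).1 (by simpa using huv)
      have := hU this
      have h := (σ.2 (σ.1⁻¹ u) (σ.1⁻¹ v)).2 this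
      simpa using h
    · intro a b
      exact hσ' a b
  unfold IsFixing
  rw [h3, h4]
  constructor
  · rintro ⟨-, h⟩ U' hU' hi
    have heq := Set.eq_of_subset_of_ncard_le hsub h.le (Set.toFinite _)
    have : U' ∈ MulAction.orbit (hpAut G) U := by rw [heq]; exact ⟨hU', hi⟩
    obtain ⟨σ, hσ⟩ := this
    exact ⟨σ.1, σ.2, (smul_iff σ U U').1 hσ⟩
  · intro h
    refine ⟨hU, ?_⟩
    congr 1
    refine Set.Subset.antisymm ?_ hsub
    rintro U' ⟨hU', hi⟩
    obtain ⟨σ, hσ, hh⟩ := h U' hU' hi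
    exact ⟨⟨σ, hσ⟩, (smul_iff ⟨σ, hσ⟩ U U').2 hh⟩

theorem hp_ham_iso {V : Type*} (G C C' : SimpleGraph V) (hC : IsHamCycle G C) (hC' : C' ≤ G)
    (e : C' ≃g C) : IsHamCycle G C' := by
  refine ⟨hC', e.connected_iff.2 hC.2.1, fun v => ?_⟩
  rw [← hC.2.2 (e v)]
  exact Nat.card_congr (e.mapNeighborSet v)

theorem hp_ll (n : ℕ) (hn : 3 ≤ n) (i j : ZMod n) :
    (genPetersen n 1).Adj (Sum.inl i) (Sum.inl j) ↔ j = i + 1 ∨ i = j + 1 := by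
  have : Fact (1 < n) := ⟨by omega⟩
  simp only [genPetersen, SimpleGraph.fromRel_adj]
  constructor
  · exact fun h => h.2
  · rintro (rfl | rfl) <;> simp

theorem hp_rr (n : ℕ) (hn : 3 ≤ n) (i j : ZMod n) :
    (genPetersen n 1).Adj (Sum.inr i) (Sum.inr j) ↔ j = i + 1 ∨ i = j + 1 := by
  have : Fact (1 < n) := ⟨by omega⟩
  simp only [genPetersen, SimpleGraph.fromRel_adj, Nat.cast_one]
  constructor
  · exact fun h => h.2
  · rintro (rfl | rfl) <;> simp

theorem hp_lr (n : ℕ) (i j : ZMod n) :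
    (genPetersen n 1).Adj (Sum.inl i) (Sum.inr j) ↔ i = j := by
  simp [genPetersen, SimpleGraph.fromRel_adj, eq_comm]

theorem hp_rl (n : ℕ) (i j : ZMod n) :
    (genPetersen n 1).Adj (Sum.inr i) (Sum.inl j) ↔ i = j := by
  simp [genPetersen, SimpleGraph.fromRel_adj]

theorem hp_cast (n c : ℕ) (h0 : 0 < c) (hc : c < n) : (c : ZMod n) ≠ 0 := by
  intro h
  rw [ZMod.natCast_eq_zero_iff] at h
  exact absurd (Nat.le_of_dvd h0 h) (by omega)

/-- local shape of a hamiltonian cycle -/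
theorem hp_degL (n : ℕ) (hn : 3 ≤ n) (C : SimpleGraph (ZMod n ⊕ ZMod n))
    (hC : IsHamCycle (genPetersen n 1) C) (i : ZMod n) :
    let x := C.Adj (Sum.inl i) (Sum.inl (i+1))
    let y := C.Adj (Sum.inl (i+1)) (Sum.inl (i+1+1))
    let z := C.Adj (Sum.inl (i+1)) (Sum.inr (i+1))
    (x ∧ y ∧ ¬z) ∨ (x ∧ ¬y ∧ z) ∨ (¬x ∧ y ∧ z) := by
  intro x y z
  have h1 := hp_cast n 1 (by omega) (by omega)
  have h2 := hp_cast n 2 (by omega) (by omega)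
  have hx : x ↔ C.Adj (Sum.inl (i+1)) (Sum.inl i) := C.adj_comm _ _
  rw [hx]
  refine hp_two {w | C.Adj (Sum.inl (i+1)) w} (Sum.inl i) (Sum.inl (i+1+1)) (Sum.inr (i+1))
    ?_ (by simp) (by simp) ?_ (hC.2.2 (Sum.inl (i+1)))
  · intro h
    push_cast at h1 h2
    have := Sum.inl.inj h
    exact h2 (by linear_combination -this)
  · rintro (j | j) hj
    · have := (hp_ll n hn _ _).1 (hC.1 hj)
      rcases this with h | h
      · simp [h]
      · simp [add_right_cancel h]
    · have := (hp_lr n _ _).1 (hC.1 hj)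
      simp [this]

/-- swap inner and outer -/
theorem hp_swap (n : ℕ) (hn : 3 ≤ n) : IsAut (genPetersen n 1) (Equiv.sumComm _ _) := by
  rintro (u | u) (v | v) <;> simp [hp_ll n hn, hp_rr n hn, hp_lr, hp_rl]

theorem hp_degR (n : ℕ) (hn : 3 ≤ n) (C : SimpleGraph (ZMod n ⊕ ZMod n))
    (hC : IsHamCycle (genPetersen n 1) C) (i : ZMod n) :
    let x := C.Adj (Sum.inr i) (Sum.inr (i+1))
    let y := C.Adj (Sum.inr (i+1)) (Sum.inr (i+1+1))
    let z := C.Adj (Sum.inl (i+1)) (Sum.inr (i+1))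
    (x ∧ y ∧ ¬z) ∨ (x ∧ ¬y ∧ z) ∨ (¬x ∧ y ∧ z) := by
  intro x y z
  have hz : z ↔ C.Adj (Sum.inr (i+1)) (Sum.inl (i+1)) := C.adj_comm _ _
  rw [hz]
  refine hp_degL n hn (C.comap (Equiv.sumComm _ _)) (hp_ham_iso _ C _ hC ?_
    ⟨Equiv.sumComm _ _, Iff.rfl⟩) i
  intro u v huv
  exact (hp_swap n hn u v).1 (hC.1 huv)

/-- type A -/
def hpA (n : ℕ) (C : SimpleGraph (ZMod n ⊕ ZMod n)) (i : ZMod n) : Prop :=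
  ∀ k, (C.Adj (Sum.inl k) (Sum.inl (k+1)) ↔ k ≠ i) ∧ (C.Adj (Sum.inr k) (Sum.inr (k+1)) ↔ k ≠ i)
    ∧ (C.Adj (Sum.inl k) (Sum.inr k) ↔ k = i ∨ k = i + 1)

/-- type B -/
def hpB (n : ℕ) (C : SimpleGraph (ZMod n ⊕ ZMod n)) : Prop :=
  ∀ k, C.Adj (Sum.inl k) (Sum.inr k) ∧
    (C.Adj (Sum.inl (k+1)) (Sum.inl (k+1+1)) ↔ ¬ C.Adj (Sum.inl k) (Sum.inl (k+1))) ∧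
    (C.Adj (Sum.inr k) (Sum.inr (k+1)) ↔ ¬ C.Adj (Sum.inl k) (Sum.inl (k+1)))

theorem hp_ind (n : ℕ) (hn : 3 ≤ n) (P : ZMod n → Prop) (k : ZMod n) (hk : P k)
    (h : ∀ i, P i → P (i+1)) (j : ZMod n) : P j := by
  have : NeZero n := ⟨by omega⟩
  have : ∀ m : ℕ, P (k + m) := by
    intro m
    induction m with
    | zero => simpa using hk
    | succ m ih => have := h _ ih; push_cast; rwa [← add_assoc]
  have h2 := this (j - k).val
  rw [ZMod.natCast_zmod_val] at h2
  simpa using h2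

/-- index -/
def hpIdx {n : ℕ} : ZMod n ⊕ ZMod n → ZMod n := Sum.elim id id

theorem hp_edge (n : ℕ) (hn : 3 ≤ n) (C : SimpleGraph (ZMod n ⊕ ZMod n))
    (hC : C ≤ genPetersen n 1) (Q : ZMod n → Prop)
    (hL : ∀ k, C.Adj (Sum.inl k) (Sum.inl (k+1)) → (Q k ↔ Q (k+1)))
    (hR : ∀ k, C.Adj (Sum.inr k) (Sum.inr (k+1)) → (Q k ↔ Q (k+1))) :
    ∀ u v, C.Adj u v → Q (hpIdx u) → Q (hpIdx v) := by
  rintro (i | i) (j | j) h hq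
  · rcases (hp_ll n hn _ _).1 (hC h) with rfl | rfl
    · exact (hL _ h).1 hq
    · exact (hL _ h.symm).2 hq
  · have := (hp_lr n _ _).1 (hC h)
    subst this; exact hq
  · have := (hp_rl n _ _).1 (hC h)
    subst this; exact hq
  · rcases (hp_rr n hn _ _).1 (hC h) with rfl | rfl
    · exact (hR _ h).1 hq
    · exact (hR _ h.symm).2 hq

theorem hp_val (n : ℕ) (hn : 3 ≤ n) (x d : ZMod n) (hx : x + 1 ≠ 0) (hd : x + 1 ≠ d) :
    x.val < d.val ↔ (x+1).val < d.val := by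
  have : NeZero n := ⟨by omega⟩
  have : Fact (1 < n) := ⟨by omega⟩
  have hlt : x.val + 1 < n := by
    by_contra hc
    have h1 := ZMod.val_lt x
    have h2 : x.val + 1 = n := by omega
    apply hx
    have h3 : ((x.val + 1 : ℕ) : ZMod n) = x + 1 := by push_cast; rw [ZMod.natCast_zmod_val]
    rw [← h3, h2]; simp
  have h1 : (x+1).val = x.val + 1 := by
    rw [ZMod.val_add_of_lt]
    · rw [ZMod.val_one]
    · rw [ZMod.val_one]; exact hlt
  have h2 : (x+1).val ≠ d.val := fun h => hd (ZMod.val_injective n h)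
  omega

theorem hp_classify (n : ℕ) (hn : 3 ≤ n) (C : SimpleGraph (ZMod n ⊕ ZMod n))
    (hC : IsHamCycle (genPetersen n 1) C) : (∃ i, hpA n C i) ∨ hpB n C := by
  have : NeZero n := ⟨by omega⟩
  have c1 := hp_cast n 1 (by omega) (by omega)
  have c2 := hp_cast n 2 (by omega) (by omega)
  push_cast at c1 c2
  have dL := hp_degL n hn C hC
  have dR := hp_degR n hn C hC
  by_cases hs : ∀ i, C.Adj (Sum.inl i) (Sum.inr i)
  · right
    by_cases hab : ∀ k, (C.Adj (Sum.inr k) (Sum.inr (k+1)) ↔ ¬ C.Adj (Sum.inl k) (Sum.inl (k+1)))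
    · intro k
      have := dL k
      have := hs (k+1)
      exact ⟨hs k, by tauto, hab k⟩
    · exfalso
      push Not at hab
      obtain ⟨k, hk⟩ := hab
      have hk' : C.Adj (Sum.inr k) (Sum.inr (k+1)) ↔ C.Adj (Sum.inl k) (Sum.inl (k+1)) := by tauto
      have hall : ∀ j, (C.Adj (Sum.inr j) (Sum.inr (j+1)) ↔ C.Adj (Sum.inl j) (Sum.inl (j+1))) := by
        refine hp_ind n hn _ k hk' ?_
        intro i hi
        have := dL i
        have := dR i
        have := hs (i+1)
        tauto
      obtain ⟨i, hi⟩ : ∃ i, C.Adj (Sum.inl (i+1)) (Sum.inl (i+1+1)) := by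
        by_cases h : C.Adj (Sum.inl (0+1)) (Sum.inl (0+1+1))
        · exact ⟨_, h⟩
        · refine ⟨0+1, ?_⟩
          have := dL (0+1)
          tauto
      have e1 : ¬ C.Adj (Sum.inl i) (Sum.inl (i+1)) := by
        have := dL i
        have := hs (i+1)
        tauto
      have e2 : ¬ C.Adj (Sum.inl (i+1+1)) (Sum.inl (i+1+1+1)) := by
        have := dL (i+1)
        have := hs (i+1+1)
        tauto
      have hQ : ∀ k, C.Adj (Sum.inl k) (Sum.inl (k+1)) →
          ((k = i+1 ∨ k = i+1+1) ↔ (k+1 = i+1 ∨ k+1 = i+1+1)) := by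
        intro k hk
        constructor
        · rintro (rfl | rfl)
          · right; rfl
          · exact absurd hk e2
        · rintro (h | h)
          · have := add_right_cancel h
            subst this
            exact absurd hk e1
          · left; exact add_right_cancel h
      have := hp_closed C hC.2.1 _ (hp_edge n hn C hC.1 _ hQ (fun k hk => hQ k ((hall k).1 hk)))
        (Sum.inl (i+1)) (Sum.inl i) (Or.inl rfl)
      rcases this with h | h
      · have h : i = i + 1 := h
        exact c1 (by linear_combination -h)
      · have h : i = i + 1 + 1 := h
        exact c2 (by linear_combination -h)
  · left
    push Not at hs
    obtain ⟨j, hj⟩ := hs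
    have hall : ∀ j, (C.Adj (Sum.inr j) (Sum.inr (j+1)) ↔ C.Adj (Sum.inl j) (Sum.inl (j+1))) := by
      refine hp_ind n hn _ j ?_ ?_
      · have h1 := dL (j-1)
        have h2 := dR (j-1)
        simp only [sub_add_cancel] at h1 h2
        tauto
      · intro i hi
        have := dL i
        have := dR i
        tauto
    obtain ⟨i, hi⟩ : ∃ i, ¬ C.Adj (Sum.inl i) (Sum.inl (i+1)) := by
      by_contra hcon
      push Not at hcon
      have hns : ∀ k, ¬ C.Adj (Sum.inl k) (Sum.inr k) := by
        intro k
        have h1 := dL (k-1)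
        have h2 := hcon (k-1)
        have h3 := hcon k
        simp only [sub_add_cancel] at h1 h2
        tauto
      have := hp_closed C hC.2.1 (fun v => v.isLeft = true) (by
        rintro (a | a) (b | b) h h2
        · rfl
        · have := (hp_lr n _ _).1 (hC.1 h)
          subst this
          exact absurd h (hns _)
        · simp at h2
        · simp at h2) (Sum.inl 0) (Sum.inr 0) rfl
      simp at this
    have huniq : ∀ l, ¬ C.Adj (Sum.inl l) (Sum.inl (l+1)) → l = i := by
      intro l hl
      by_contra hli
      have hQ : ∀ k, C.Adj (Sum.inl k) (Sum.inl (k+1)) →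
          ((k - i - 1).val < (l - i).val ↔ (k + 1 - i - 1).val < (l - i).val) := by
        intro k hk
        have e : k + 1 - i - 1 = (k - i - 1) + 1 := by ring
        rw [e]
        apply hp_val n hn
        · intro h
          have : k = i := by linear_combination h
          subst this; exact hi hk
        · intro h
          have : k = l := by linear_combination h
          subst this; exact hl hk
      have := hp_closed C hC.2.1 _ (hp_edge n hn C hC.1 _ hQ (fun k hk => hQ k ((hall k).1 hk)))
        (Sum.inl (i+1)) (Sum.inl i) (by
          have e : hpIdx (Sum.inl (i+1) : ZMod n ⊕ ZMod n) - i - 1 = 0 := by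
            change i + 1 - i - 1 = 0
            ring
          rw [e, ZMod.val_zero, ZMod.val_pos]
          exact sub_ne_zero.2 hli)
      have e : hpIdx (Sum.inl i : ZMod n ⊕ ZMod n) - i - 1 = -1 := by
        change i - i - 1 = -1
        ring
      rw [e] at this
      obtain ⟨m, rfl⟩ : ∃ m, n = m + 1 := ⟨n - 1, by omega⟩
      rw [ZMod.val_neg_one] at this
      have := ZMod.val_lt (l - i)
      omega
    refine ⟨i, fun k => ?_⟩
    have ha : ∀ k, C.Adj (Sum.inl k) (Sum.inl (k+1)) ↔ k ≠ i := by
      intro k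
      constructor
      · rintro h rfl; exact hi h
      · intro h; by_contra h2; exact h (huniq k h2)
    refine ⟨ha k, (hall k).trans (ha k), ?_⟩
    have h1 := dL (k-1)
    simp only [sub_add_cancel] at h1
    have h2 := ha (k-1)
    simp only [sub_add_cancel] at h2
    rw [h2, ha k] at h1
    have e : k - 1 = i ↔ k = i + 1 := sub_eq_iff_eq_add
    rw [← e]
    have e3 : ¬ (k = i ∧ k - 1 = i) := by
      rintro ⟨rfl, h⟩
      exact c1 (by linear_combination -h)
    tauto

theorem hp_B_even (n : ℕ) (C : SimpleGraph (ZMod n ⊕ ZMod n))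
    (hB : hpB n C) : ¬ Odd n := by
  intro hodd
  have : ∀ m : ℕ, C.Adj (Sum.inl ((m:ZMod n))) (Sum.inl ((m:ZMod n)+1)) ↔
      (Even m ↔ C.Adj (Sum.inl (0:ZMod n)) (Sum.inl (0+1))) := by
    intro m
    induction m with
    | zero => simp
    | succ m ih =>
      have := (hB m).2.1
      push_cast
      rw [this, ih, Nat.even_add_one]
      tauto
  have h := this n
  rw [ZMod.natCast_self] at h
  rw [← Nat.not_even_iff_odd] at hodd
  tauto

end helpers

section helpers2

/-- graph from edge data -/
def hpGr {n : ℕ} (α β s : ZMod n → Bool) : ZMod n ⊕ ZMod n → ZMod n ⊕ ZMod n → Bool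
  | Sum.inl i, Sum.inl j => (decide (j = i + 1) && α i) || (decide (i = j + 1) && α j)
  | Sum.inr i, Sum.inr j => (decide (j = i + 1) && β i) || (decide (i = j + 1) && β j)
  | Sum.inl i, Sum.inr j => decide (i = j) && s i
  | Sum.inr i, Sum.inl j => decide (i = j) && s i

theorem hp_gr (n : ℕ) (hn : 3 ≤ n) (C : SimpleGraph (ZMod n ⊕ ZMod n)) (hC : C ≤ genPetersen n 1)
    (α β s : ZMod n → Bool)
    (hα : ∀ k, C.Adj (Sum.inl k) (Sum.inl (k+1)) ↔ α k = true)
    (hβ : ∀ k, C.Adj (Sum.inr k) (Sum.inr (k+1)) ↔ β k = true)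
    (hs : ∀ k, C.Adj (Sum.inl k) (Sum.inr k) ↔ s k = true) (u v) :
    C.Adj u v ↔ hpGr α β s u v = true := by
  rcases u with i | i <;> rcases v with j | j <;>
    simp only [hpGr, Bool.or_eq_true, Bool.and_eq_true, decide_eq_true_eq]
  · constructor
    · intro h
      rcases (hp_ll n hn _ _).1 (hC h) with rfl | rfl
      · exact Or.inl ⟨rfl, (hα _).1 h⟩
      · exact Or.inr ⟨rfl, (hα _).1 h.symm⟩
    · rintro (⟨rfl, h⟩ | ⟨rfl, h⟩)
      · exact (hα _).2 h
      · exact ((hα _).2 h).symm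
  · constructor
    · intro h
      have := (hp_lr n _ _).1 (hC h)
      subst this
      exact ⟨rfl, (hs _).1 h⟩
    · rintro ⟨rfl, h⟩
      exact (hs _).2 h
  · constructor
    · intro h
      have := (hp_rl n _ _).1 (hC h)
      subst this
      exact ⟨rfl, (hs _).1 h.symm⟩
    · rintro ⟨rfl, h⟩
      exact ((hs _).2 h).symm
  · constructor
    · intro h
      rcases (hp_rr n hn _ _).1 (hC h) with rfl | rfl
      · exact Or.inl ⟨rfl, (hβ _).1 h⟩
      · exact Or.inr ⟨rfl, (hβ _).1 h.symm⟩
    · rintro (⟨rfl, h⟩ | ⟨rfl, h⟩)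
      · exact (hβ _).2 h
      · exact ((hβ _).2 h).symm

theorem hp_grA (n : ℕ) (hn : 3 ≤ n) (C : SimpleGraph (ZMod n ⊕ ZMod n)) (hC : C ≤ genPetersen n 1)
    (i : ZMod n) (hA : hpA n C i) (u v) : C.Adj u v ↔
      hpGr (fun k => decide (k ≠ i)) (fun k => decide (k ≠ i))
        (fun k => decide (k = i ∨ k = i + 1)) u v = true := by
  apply hp_gr n hn C hC
  · intro k; rw [(hA k).1]; simp
  · intro k; rw [(hA k).2.1]; simp
  · intro k; rw [(hA k).2.2]; simp

/-- similarity -/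
def hpSim {V : Type*} (G C C' : SimpleGraph V) : Prop :=
  ∃ σ : Equiv.Perm V, IsAut G σ ∧ ∀ u v, C'.Adj (σ u) (σ v) ↔ C.Adj u v

theorem hpSim.symm {V : Type*} {G C C' : SimpleGraph V} (h : hpSim G C C') : hpSim G C' C := by
  obtain ⟨σ, h1, h2⟩ := h
  refine ⟨σ⁻¹, (hpAut G).inv_mem h1, fun u v => ?_⟩
  rw [← h2]; simp

theorem hpSim.trans {V : Type*} {G C C' C'' : SimpleGraph V} (h : hpSim G C C')
    (h' : hpSim G C' C'') : hpSim G C C'' := by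
  obtain ⟨σ, h1, h2⟩ := h
  obtain ⟨τ, h3, h4⟩ := h'
  refine ⟨τ * σ, (hpAut G).mul_mem h3 h1, fun u v => ?_⟩
  rw [← h2, ← h4]; rfl

theorem hp_rot (n : ℕ) (hn : 3 ≤ n) (d : ZMod n) :
    IsAut (genPetersen n 1) (Equiv.sumCongr (Equiv.addRight d) (Equiv.addRight d)) := by
  have e : ∀ i j : ZMod n, i + d = j + d + 1 ↔ i = j + 1 := by
    intro i j
    rw [add_right_comm, add_left_inj]
  rintro (u | u) (v | v) <;> simp [hp_ll n hn, hp_rr n hn, hp_lr, hp_rl, e]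

theorem hp_simAA (n : ℕ) (hn : 3 ≤ n) (C C' : SimpleGraph (ZMod n ⊕ ZMod n))
    (hC : C ≤ genPetersen n 1) (hC' : C' ≤ genPetersen n 1) (i i' : ZMod n)
    (hA : hpA n C i) (hA' : hpA n C' i') : hpSim (genPetersen n 1) C C' := by
  refine ⟨_, hp_rot n hn (i' - i), fun u v => ?_⟩
  rw [hp_grA n hn C hC i hA, hp_grA n hn C' hC' i' hA']
  have e1 : ∀ k l : ZMod n, k + (i' - i) = l + (i' - i) + 1 ↔ k = l + 1 := by
    intro k l
    rw [add_right_comm, add_left_inj]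
  have e2 : ∀ k : ZMod n, k + (i' - i) = i' ↔ k = i := by
    intro k
    constructor <;> intro h <;> linear_combination h
  have e3 : ∀ k : ZMod n, k + (i' - i) = i' + 1 ↔ k = i + 1 := by
    intro k
    constructor <;> intro h <;> linear_combination h
  rcases u with u | u <;> rcases v with v | v <;> simp [hpGr, e1, e2, e3]

theorem hp_cycadj (m : ℕ) (hm : 3 ≤ m) (u v : Fin m) : (SimpleGraph.cycleGraph m).Adj u v ↔
    (u.val + 1 = v.val ∨ v.val + 1 = u.val ∨ (u.val = 0 ∧ v.val = m - 1) ∨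
      (v.val = 0 ∧ u.val = m - 1)) := by
  rw [SimpleGraph.cycleGraph_adj']
  have hu := u.2
  have hv := v.2
  rcases lt_trichotomy u v with h | h | h
  · rw [Fin.coe_sub_iff_lt.2 h, Fin.sub_val_of_le h.le]
    have : u.val < v.val := h
    omega
  · subst h
    rw [Fin.sub_val_of_le le_rfl]
    omega
  · rw [Fin.coe_sub_iff_lt.2 h, Fin.sub_val_of_le h.le]
    have : v.val < u.val := h
    omega

theorem hp_cyc (n : ℕ) (hn : 3 ≤ n) (f : ℕ → ZMod n ⊕ ZMod n)
    (hf : ∀ v, ∃ t < 2 * n, f t = v)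
    (h1 : ∀ t, t + 1 < 2 * n → (genPetersen n 1).Adj (f t) (f (t+1)))
    (h2 : (genPetersen n 1).Adj (f 0) (f (2*n-1))) :
    ∃ C, IsHamCycle (genPetersen n 1) C ∧ Nonempty (SimpleGraph.cycleGraph (2*n) ≃g C) ∧
      ∀ s t, s < 2 * n → t < 2 * n → (C.Adj (f s) (f t) ↔
        (s + 1 = t ∨ t + 1 = s ∨ (s = 0 ∧ t = 2*n-1) ∨ (t = 0 ∧ s = 2*n-1))) := by
  have : NeZero n := ⟨by omega⟩
  have hbij : Function.Bijective (fun t : Fin (2*n) => f t) := by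
    rw [Fintype.bijective_iff_surjective_and_card]
    constructor
    · intro v
      obtain ⟨t, ht, h⟩ := hf v
      exact ⟨⟨t, ht⟩, h⟩
    · simp [ZMod.card, two_mul]
  let e := Equiv.ofBijective _ hbij
  have he : ∀ t (ht : t < 2*n), e.symm (f t) = ⟨t, ht⟩ := by
    intro t ht
    rw [Equiv.symm_apply_eq]; rfl
  let C := (SimpleGraph.cycleGraph (2*n)).comap e.symm
  let I : C ≃g SimpleGraph.cycleGraph (2*n) := ⟨e.symm, Iff.rfl⟩
  have hadj : ∀ s t, s < 2 * n → t < 2 * n → (C.Adj (f s) (f t) ↔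
        (s + 1 = t ∨ t + 1 = s ∨ (s = 0 ∧ t = 2*n-1) ∨ (t = 0 ∧ s = 2*n-1))) := by
    intro s t hs ht
    change (SimpleGraph.cycleGraph (2*n)).Adj _ _ ↔ _
    rw [he s hs, he t ht, hp_cycadj _ (by omega)]
  refine ⟨C, ⟨?_, ?_, ?_⟩, ⟨I.symm⟩, hadj⟩
  · intro u v
    obtain ⟨s, hs, rfl⟩ := hf u
    obtain ⟨t, ht, rfl⟩ := hf v
    rw [hadj s t hs ht]
    rintro (rfl | rfl | ⟨rfl, rfl⟩ | ⟨rfl, rfl⟩)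
    · exact h1 _ ht
    · exact (h1 _ hs).symm
    · exact h2
    · exact h2.symm
  · rw [I.connected_iff]
    obtain ⟨m, hm⟩ : ∃ m, 2 * n = m + 1 := ⟨2*n-1, by omega⟩
    rw [hm]
    exact SimpleGraph.cycleGraph_connected
  · intro v
    refine (Nat.card_congr (I.mapNeighborSet v)).trans ?_
    generalize I v = w
    obtain ⟨m, hm⟩ : ∃ m, 2 * n = m + 3 := ⟨2*n-3, by omega⟩
    clear_value I C e
    revert w
    rw [hm]
    intro w
    rw [Nat.card_eq_fintype_card, SimpleGraph.card_neighborSet_eq_degree]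
    exact SimpleGraph.cycleGraph_degree_three_le

theorem hp_existsA (n : ℕ) (hn : 3 ≤ n) : ∃ C, IsHamCycle (genPetersen n 1) C ∧
    Nonempty (SimpleGraph.cycleGraph (2*n) ≃g C) ∧ ¬ C.Adj (Sum.inl 1) (Sum.inr 1) := by
  have : NeZero n := ⟨by omega⟩
  refine Exists.elim (hp_cyc n hn
    (fun t => if t < n then Sum.inl (t : ZMod n) else Sum.inr ((2*n-1-t : ℕ) : ZMod n)) ?_ ?_ ?_)
    (fun C hC => ?_)
  rotate_right 1
  · obtain ⟨h1, h2, h3⟩ := hC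
    refine ⟨C, h1, h2, ?_⟩
    have := h3 1 (2*n-2) (by omega) (by omega)
    have e : 2 * n - 1 - (2*n-2) = 1 := by omega
    simp only [e] at this
    rw [if_pos (by omega), if_neg (by omega)] at this
    push_cast at this
    rw [this]
    omega
  · rintro (i | i)
    · have := ZMod.val_lt i
      refine ⟨i.val, by omega, ?_⟩
      simp [this]
    · have := ZMod.val_lt i
      refine ⟨2*n-1-i.val, by omega, ?_⟩
      have e : 2*n-1-(2*n-1-i.val) = i.val := by omega
      simp only [e]
      rw [if_neg (by omega)]
      simp
  · intro t ht
    split_ifs with a b b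
    · rw [hp_ll n hn]; left; push_cast; rfl
    · rw [hp_lr]; congr 1; omega
    · omega
    · rw [hp_rr n hn]; right
      have e : 2*n-1-t = 2*n-1-(t+1) + 1 := by omega
      rw [e]; push_cast; rfl
  · rw [if_pos (by omega), if_neg (by omega), hp_lr]
    simp

theorem hp_existsB (n : ℕ) (hn : 3 ≤ n) (hev : Even n) : ∃ C, IsHamCycle (genPetersen n 1) C ∧
    Nonempty (SimpleGraph.cycleGraph (2*n) ≃g C) ∧ ∀ i, C.Adj (Sum.inl i) (Sum.inr i) := by
  have : NeZero n := ⟨by omega⟩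
  obtain ⟨r, hr⟩ := hev
  let f : ℕ → ZMod n ⊕ ZMod n := fun t =>
    if t % 4 < 2 then Sum.inl (((t+1)/2 : ℕ) : ZMod n) else Sum.inr (((t+1)/2 : ℕ) : ZMod n)
  have fl : ∀ t m : ℕ, t % 4 < 2 → (t+1)/2 = m → f t = Sum.inl (m : ZMod n) := by
    intro t m h1 h2
    simp only [f, if_pos h1, h2]
  have fr : ∀ t m : ℕ, 2 ≤ t % 4 → (t+1)/2 = m → f t = Sum.inr (m : ZMod n) := by
    intro t m h1 h2
    simp only [f, if_neg (not_lt.2 h1), h2]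
  have cl : f (2*n-1) = Sum.inr 0 := by
    rw [fr (2*n-1) n (by omega) (by omega)]; simp
  have op : f 0 = Sum.inl 0 := by
    rw [fl 0 0 (by omega) (by omega)]; simp
  refine Exists.elim (hp_cyc n hn f ?_ ?_ ?_) (fun C hC => ?_)
  rotate_right 1
  · obtain ⟨h1, h2, h3⟩ := hC
    refine ⟨C, h1, h2, ?_⟩
    intro i
    have hi := ZMod.val_lt i
    rw [← ZMod.natCast_zmod_val i]
    generalize i.val = k at hi
    rcases Nat.eq_zero_or_pos k with rfl | hk
    · have := h3 0 (2*n-1) (by omega) (by omega)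
      rw [cl, op] at this
      simpa using this
    · rcases Nat.mod_two_eq_zero_or_one k with h | h
      · rw [← fl (2*k) k (by omega) (by omega), ← fr (2*k-1) k (by omega) (by omega),
          h3 _ _ (by omega) (by omega)]
        omega
      · rw [← fl (2*k-1) k (by omega) (by omega), ← fr (2*k) k (by omega) (by omega),
          h3 _ _ (by omega) (by omega)]
        omega
  · rintro (i | i)
    · have hi := ZMod.val_lt i
      rw [← ZMod.natCast_zmod_val i]
      generalize i.val = k at hi
      rcases Nat.mod_two_eq_zero_or_one k with h | h
      · exact ⟨2*k, by omega, fl (2*k) k (by omega) (by omega)⟩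
      · exact ⟨2*k-1, by omega, fl _ k (by omega) (by omega)⟩
    · have hi := ZMod.val_lt i
      rw [← ZMod.natCast_zmod_val i]
      generalize i.val = k at hi
      rcases Nat.eq_zero_or_pos k with rfl | hk
      · exact ⟨2*n-1, by omega, by simpa using cl⟩
      rcases Nat.mod_two_eq_zero_or_one k with h | h
      · exact ⟨2*k-1, by omega, fr _ k (by omega) (by omega)⟩
      · exact ⟨2*k, by omega, fr _ k (by omega) (by omega)⟩
  · intro t ht
    obtain ⟨q, hq⟩ : ∃ q, q = t / 2 := ⟨_, rfl⟩
    have hc : t % 4 = 0 ∨ t % 4 = 1 ∨ t % 4 = 2 ∨ t % 4 = 3 := by omega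
    rcases hc with h | h | h | h
    · rw [fl t q (by omega) (by omega), fl (t+1) (q+1) (by omega) (by omega), hp_ll n hn]
      left; push_cast; rfl
    · rw [fl t (q+1) (by omega) (by omega), fr (t+1) (q+1) (by omega) (by omega), hp_lr]
    · rw [fr t q (by omega) (by omega), fr (t+1) (q+1) (by omega) (by omega), hp_rr n hn]
      left; push_cast; rfl
    · rw [fr t (q+1) (by omega) (by omega), fl (t+1) (q+1) (by omega) (by omega), hp_rl]
  · rw [cl, op, hp_lr]

/-- edge in two squares -/
def hpP {V : Type*} (G : SimpleGraph V) (x y : V) : Prop :=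
  G.Adj x y ∧ ∀ x', G.Adj x x' → x' ≠ y → ∃ y', G.Adj y y' ∧ y' ≠ x ∧ G.Adj x' y'

theorem hp_P_aut {V : Type*} (G : SimpleGraph V) (σ : Equiv.Perm V) (hσ : IsAut G σ) (x y : V)
    (h : hpP G x y) : hpP G (σ x) (σ y) := by
  refine ⟨(hσ _ _).2 h.1, ?_⟩
  intro x' hx hne
  obtain ⟨z, rfl⟩ := σ.surjective x'
  obtain ⟨y', h1, h2, h3⟩ := h.2 z ((hσ _ _).1 hx) (fun h => hne (by rw [h]))
  exact ⟨σ y', (hσ _ _).2 h1, fun h => h2 (σ.injective h), (hσ _ _).2 h3⟩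

theorem hp_P_spoke (n : ℕ) (hn : 3 ≤ n) (i : ZMod n) :
    hpP (genPetersen n 1) (Sum.inl i) (Sum.inr i) := by
  refine ⟨(hp_lr n _ _).2 rfl, ?_⟩
  rintro (j | j) h hne
  · refine ⟨Sum.inr j, ?_, by simp, (hp_lr n _ _).2 rfl⟩
    rw [hp_rr n hn, ← hp_ll n hn]; exact h
  · exact absurd (by rw [(hp_lr n _ _).1 h]) hne

theorem hp_not_P (n : ℕ) (hn : 5 ≤ n) (i j : ZMod n) :
    ¬ hpP (genPetersen n 1) (Sum.inl i) (Sum.inl j) := by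
  have c1 := hp_cast n 1 (by omega) (by omega)
  have c2 := hp_cast n 2 (by omega) (by omega)
  have c4 := hp_cast n 4 (by omega) (by omega)
  push_cast at c1 c2 c4
  have hn3 : 3 ≤ n := by omega
  rintro ⟨h, hh⟩
  rcases (hp_ll n hn3 _ _).1 h with rfl | rfl
  · obtain ⟨y', a, b, c⟩ := hh (Sum.inl (i - 1)) ((hp_ll n hn3 _ _).2 (by right; ring)) (by
      intro h
      have := Sum.inl.inj h
      exact c2 (by linear_combination -this))
    rcases y' with k | k
    · rw [hp_ll n hn3] at a c
      have b : k ≠ i := fun h => b (by rw [h])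
      grind
    · rw [hp_lr] at a c
      exact c2 (by linear_combination a - c)
  · obtain ⟨y', a, b, c⟩ := hh (Sum.inl (j + 1 + 1)) ((hp_ll n hn3 _ _).2 (by left; ring)) (by
      intro h
      have := Sum.inl.inj h
      exact c2 (by linear_combination this))
    rcases y' with k | k
    · rw [hp_ll n hn3] at a c
      have b : k ≠ j + 1 := fun h => b (by rw [h])
      grind
    · rw [hp_lr] at a c
      exact c2 (by linear_combination c - a)

theorem hp_P_inv (n : ℕ) (hn : 5 ≤ n) (x y : ZMod n ⊕ ZMod n)
    (h : hpP (genPetersen n 1) x y) : ∃ i, (x = Sum.inl i ∧ y = Sum.inr i) ∨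
      (x = Sum.inr i ∧ y = Sum.inl i) := by
  rcases x with i | i <;> rcases y with j | j
  · exact absurd h (hp_not_P n hn i j)
  · have := (hp_lr n _ _).1 h.1
    subst this
    exact ⟨i, Or.inl ⟨rfl, rfl⟩⟩
  · have := (hp_rl n _ _).1 h.1
    subst this
    exact ⟨i, Or.inr ⟨rfl, rfl⟩⟩
  · exact absurd (hp_P_aut _ _ (hp_swap n (by omega)) _ _ h) (hp_not_P n hn i j)

instance hpDec : DecidableRel (genPetersen 4 1).Adj
  | Sum.inl i, Sum.inl j => decidable_of_iff _ (hp_ll 4 (by omega) i j).symm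
  | Sum.inr i, Sum.inr j => decidable_of_iff _ (hp_rr 4 (by omega) i j).symm
  | Sum.inl i, Sum.inr j => decidable_of_iff _ (hp_lr 4 i j).symm
  | Sum.inr i, Sum.inl j => decidable_of_iff _ (hp_rl 4 i j).symm

/-- cube symmetry -/
def hpF (p : Bool) : ZMod 4 ⊕ ZMod 4 → ZMod 4 ⊕ ZMod 4 :=
  bif p then Sum.elim (fun i : Fin 4 => ![Sum.inl 0, Sum.inl 3, Sum.inr 3, Sum.inr 0] i)
    (fun i : Fin 4 => ![Sum.inl 1, Sum.inl 2, Sum.inr 2, Sum.inr 1] i)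
  else Sum.elim (fun i : Fin 4 => ![Sum.inl 0, Sum.inl 1, Sum.inr 1, Sum.inr 0] i)
    (fun i : Fin 4 => ![Sum.inl 3, Sum.inl 2, Sum.inr 2, Sum.inr 3] i)

set_option maxRecDepth 100000 in
theorem hp_F1 : ∀ p, Function.Injective (hpF p) := by
  unfold Function.Injective
  decide

set_option maxRecDepth 100000 in
theorem hp_F2 : ∀ p u v, (genPetersen 4 1).Adj (hpF p u) (hpF p v) ↔ (genPetersen 4 1).Adj u v := by
  decide

set_option maxRecDepth 100000 in
theorem hp_F3 : ∀ p u v, hpGr (n := 4) (fun k => decide (k = 0 ∨ k = 2) == p)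
    (fun k => !(decide (k = 0 ∨ k = 2) == p)) (fun _ => true) (hpF p u) (hpF p v) =
      hpGr (n := 4) (fun k => decide (k ≠ 0)) (fun k => decide (k ≠ 0))
        (fun k => decide (k = 0 ∨ k = 0 + 1)) u v := by
  decide

theorem hp_simAB (C C' : SimpleGraph (ZMod 4 ⊕ ZMod 4))
    (hC : C ≤ genPetersen 4 1) (hC' : C' ≤ genPetersen 4 1)
    (hA : hpA 4 C 0) (hB : hpB 4 C') : hpSim (genPetersen 4 1) C C' := by
  classical
  let p : Bool := decide (C'.Adj (Sum.inl 0) (Sum.inl (0+1)))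
  have hα : ∀ k, C'.Adj (Sum.inl k) (Sum.inl (k+1)) ↔
      (decide (k = 0 ∨ k = 2) == p) = true := by
    have a0 := (hB 0).2.1
    have a1 := (hB (0+1)).2.1
    have a2 := (hB (0+1+1)).2.1
    have hp : p = true ↔ C'.Adj (Sum.inl 0) (Sum.inl (0+1)) := by simp [p]
    intro k
    have hk : ∀ k : ZMod 4, k = 0 ∨ k = 0 + 1 ∨ k = 0 + 1 + 1 ∨ k = 0 + 1 + 1 + 1 := by decide
    have d0 : ((0 : ZMod 4) = 0 ∨ (0 : ZMod 4) = 2) := by decide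
    have d1 : ¬ ((0 + 1 : ZMod 4) = 0 ∨ (0 + 1 : ZMod 4) = 2) := by decide
    have d2 : ((0 + 1 + 1 : ZMod 4) = 0 ∨ (0 + 1 + 1 : ZMod 4) = 2) := by decide
    have d3 : ¬ ((0 + 1 + 1 + 1 : ZMod 4) = 0 ∨ (0 + 1 + 1 + 1 : ZMod 4) = 2) := by decide
    rcases hk k with rfl | rfl | rfl | rfl
    · rw [decide_eq_true d0, ← hp]; simp
    · rw [decide_eq_false d1, a0, ← hp]; simp
    · rw [decide_eq_true d2, a1, a0, ← hp]; simp
    · rw [decide_eq_false d3, a2, a1, a0, ← hp]; simp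
  have hg := hp_gr 4 (by omega) C' hC' (fun k => decide (k = 0 ∨ k = 2) == p)
    (fun k => !(decide (k = 0 ∨ k = 2) == p)) (fun _ => true) hα
    (fun k => by rw [(hB k).2.2, hα k]; simp) (fun k => by simp [(hB k).1])
  refine ⟨Equiv.ofBijective _ (Finite.injective_iff_bijective.1 (hp_F1 p)), hp_F2 p, fun u v => ?_⟩
  rw [hp_grA 4 (by omega) C hC 0 hA, ← hp_F3 p u v]
  exact hg _ _

theorem hp_simAB' (C C' : SimpleGraph (ZMod 4 ⊕ ZMod 4))
    (hC : C ≤ genPetersen 4 1) (hC' : C' ≤ genPetersen 4 1) (i : ZMod 4)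
    (hA : hpA 4 C i) (hB : hpB 4 C') : hpSim (genPetersen 4 1) C C' := by
  let C0 := C.comap (Equiv.sumCongr (Equiv.addRight i) (Equiv.addRight i))
  have h1 : C0 ≤ genPetersen 4 1 := by
    intro u v h
    exact (hp_rot 4 (by omega) i u v).1 (hC h)
  have h2 : hpA 4 C0 0 := by
    intro k
    have := hA (k + i)
    rw [add_right_comm] at this
    refine ⟨this.1.trans ?_, this.2.1.trans ?_, this.2.2.trans ?_⟩
    · simp
    · simp
    · rw [add_comm i 1]; simp
  exact (hp_simAA 4 (by omega) C C0 hC h1 i 0 hA h2).trans (hp_simAB C0 C' h1 hC' h2 hB)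

end helpers2

/-- **Theorem 7(ii).** The `n`-prism `G(n,1)` belongs to `F(HAM)` iff `n` is odd or `n = 4`. -/
theorem genPetersen_one_inFHAM_iff (n : ℕ) (hn : 3 ≤ n) :
    InFHAM (genPetersen n 1) ↔ Odd n ∨ n = 4 := by
  have : NeZero n := ⟨by omega⟩
  obtain ⟨A, hA, ⟨eA⟩, hA1⟩ := hp_existsA n hn
  constructor
  · rintro ⟨-, hfix⟩
    by_contra hcon
    push Not at hcon
    obtain ⟨hodd, h4⟩ := hcon
    rw [Nat.not_odd_iff_even] at hodd
    have h5 : 5 ≤ n := by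
      obtain ⟨r, hr⟩ := hodd
      omega
    obtain ⟨B, hB, ⟨eB⟩, hB1⟩ := hp_existsB n hn hodd
    obtain ⟨σ, h1, h2⟩ := (hp_fixing _ A hA.1).1 (hfix A hA) B hB.1 ⟨eB.symm.trans eA⟩
    obtain ⟨i, hi⟩ := hp_P_inv n h5 _ _ (hp_P_aut _ σ h1 _ _ (hp_P_spoke n hn 1))
    apply hA1
    rw [← h2]
    rcases hi with ⟨a, b⟩ | ⟨a, b⟩
    · rw [a, b]; exact hB1 i
    · rw [a, b]; exact (hB1 i).symm
  · intro h
    refine ⟨⟨A, hA⟩, fun C hC => (hp_fixing _ C hC.1).2 ?_⟩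
    rintro C' hC' ⟨e⟩
    have hH := hp_ham_iso _ C C' hC hC' e
    change hpSim _ C C'
    rcases h with h | rfl
    · rcases hp_classify n hn C hC with ⟨i, hi⟩ | hb
      · rcases hp_classify n hn C' hH with ⟨j, hj⟩ | hb
        · exact hp_simAA n hn C C' hC.1 hC' i j hi hj
        · exact absurd h (hp_B_even n C' hb)
      · exact absurd h (hp_B_even n C hb)
    · obtain ⟨i, hi⟩ : ∃ i, hpA 4 A i := by
        rcases hp_classify 4 hn A hA with h | hb
        · exact h
        · exact absurd (hb 1).1 hA1
      have key : ∀ C, IsHamCycle (genPetersen 4 1) C → hpSim (genPetersen 4 1) A C := by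
        intro C hC
        rcases hp_classify 4 hn C hC with ⟨j, hj⟩ | hb
        · exact hp_simAA 4 hn A C hA.1 hC.1 i j hi hj
        · exact hp_simAB' A C hA.1 hC.1 i hi hb
      exact (key C hC).symm.trans (key C' hH)
end

section
/- For every n ≥ 7, the generalized Petersen graph G(n,3) is hamiltonian, i.e., it contains a connected 2-regular spanning subgraph. -/
namespace GP3

open SimpleGraph

abbrev A (n t : ℕ) : ZMod n ⊕ ZMod n := Sum.inl (t : ZMod n)
abbrev B (n t : ℕ) : ZMod n ⊕ ZMod n := Sum.inr (t : ZMod n)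

lemma natCast_ne {n : ℕ} {d : ℕ} (h0 : 0 < d) (h1 : d < n) : (d : ZMod n) ≠ 0 := by
  intro h
  rw [ZMod.natCast_eq_zero_iff] at h
  exact absurd (Nat.le_of_dvd h0 h) (by omega)

variable {n : ℕ}

lemma adjA (hn : 7 ≤ n) {s t : ℕ} (h : t = s + 1) : (genPetersen n 3).Adj (A n s) (A n t) := by
  have := natCast_ne (n := n) (d := 1) (by omega) (by omega)
  subst h
  simp [genPetersen, SimpleGraph.fromRel_adj] at *
  exact this

lemma adjAB {t : ℕ} : (genPetersen n 3).Adj (A n t) (B n t) := by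
  simp [genPetersen, SimpleGraph.fromRel_adj]

lemma adjB (hn : 7 ≤ n) {s t : ℕ} (h : t = s + 3 ∨ t + n = s + 3) :
    (genPetersen n 3).Adj (B n s) (B n t) := by
  have h3 := natCast_ne (n := n) (d := 3) (by omega) (by omega)
  have ht : (t : ZMod n) = s + 3 := by
    rcases h with h | h
    · subst h; push_cast; rfl
    · have := congrArg (Nat.cast : ℕ → ZMod n) h
      push_cast at this
      simpa using this
  simp only [genPetersen, SimpleGraph.fromRel_adj, B, ht]
  push_cast at h3
  refine ⟨?_, Or.inl (by push_cast; rfl)⟩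
  simpa using h3

lemma up (hn : 7 ≤ n) (c j : ℕ) : ∀ x, x = c + 3 * j →
    ∃ p : (genPetersen n 3).Walk (B n c) (B n x), p.length = j ∧
      ∀ t, c ≤ t → t ≤ x → t % 3 = c % 3 → B n t ∈ p.support := by
  induction j with
  | zero =>
    intro x hx
    obtain rfl : x = c := by omega
    refine ⟨Walk.nil, rfl, fun t h1 h2 _ => ?_⟩
    obtain rfl : t = x := by omega
    simp
  | succ j ih =>
    intro x hx
    obtain ⟨p, hl, hs⟩ := ih (c + 3 * j) rfl
    refine ⟨p.concat (adjB hn (Or.inl (by omega))), by simp [hl], fun t h1 h2 h3 => ?_⟩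
    rw [Walk.support_concat]
    by_cases h : t = x
    · subst h; simp
    · have := hs t h1 (by omega) h3
      simp [this]

lemma down (hn : 7 ≤ n) (c j x : ℕ) (hx : x = c + 3 * j) :
    ∃ p : (genPetersen n 3).Walk (B n x) (B n c), p.length = j ∧
      ∀ t, c ≤ t → t ≤ x → t % 3 = c % 3 → B n t ∈ p.support := by
  obtain ⟨p, hl, hs⟩ := up hn c j x hx
  exact ⟨p.reverse, by simp [hl], by simpa using hs⟩

lemma outer (hn : 7 ≤ n) (c j : ℕ) : ∀ x, x = c + j →
    ∃ p : (genPetersen n 3).Walk (A n c) (A n x), p.length = j ∧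
      ∀ t, c ≤ t → t ≤ x → A n t ∈ p.support := by
  induction j with
  | zero =>
    intro x hx
    obtain rfl : x = c := by omega
    refine ⟨Walk.nil, rfl, fun t h1 h2 => ?_⟩
    obtain rfl : t = x := by omega
    simp
  | succ j ih =>
    intro x hx
    obtain ⟨p, hl, hs⟩ := ih (c + j) rfl
    refine ⟨p.concat (adjA hn (by omega)), by simp [hl], fun t h1 h2 => ?_⟩
    rw [Walk.support_concat]
    by_cases h : t = x
    · subst h; simp
    · have := hs t h1 (by omega)
      simp [this]

lemma finish (hn : 7 ≤ n) {u v : ZMod n ⊕ ZMod n} (q : (genPetersen n 3).Walk u v)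
    (hvu : (genPetersen n 3).Adj v u) (hl : q.length + 1 = 2 * n)
    (hA : ∀ t < n, A n t ∈ q.support) (hB : ∀ t < n, B n t ∈ q.support) :
    ∃ C, IsHamCycle (genPetersen n 3) C := by
  classical
  haveI : NeZero n := ⟨by omega⟩
  have hall : ∀ x, x ∈ q.support := by
    rintro (i | i)
    · simpa [A] using hA i.val (ZMod.val_lt i)
    · simpa [B] using hB i.val (ZMod.val_lt i)
  have hq : q.IsPath := by
    rw [Walk.isPath_def, ← Multiset.coe_nodup, ← Multiset.toFinset_card_eq_card_iff_nodup,
      Multiset.coe_card, List.toFinset_coe]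
    have : q.support.toFinset = Finset.univ := by ext; simp [hall]
    rw [this, Walk.length_support, hl]
    simp [ZMod.card]; omega
  have hc : (Walk.cons hvu q).IsCycle := by
    rw [Walk.cons_isCycle_iff]
    refine ⟨hq, fun h => ?_⟩
    have := hq.length_eq_one_of_mem_edges (Sym2.eq_swap ▸ h)
    omega
  set c := Walk.cons hvu q with hcdef
  have hall' : ∀ x, x ∈ c.support := fun x => by simp [hcdef, hall]
  refine ⟨c.toSubgraph.spanningCoe, c.toSubgraph.spanningCoe_le, ?_, fun x => ?_⟩
  · have h1 := c.toSubgraph_connected.coe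
    refine h1.map (⟨Subtype.val, ?_⟩ : c.toSubgraph.coe →g c.toSubgraph.spanningCoe) ?_
    · intro a b h; simpa using h
    · intro x; exact ⟨⟨x, by simp [hall']⟩, rfl⟩
  · have := hc.ncard_neighborSet_toSubgraph_eq_two (hall' x)
    rw [← Nat.card_coe_set_eq] at this
    exact this

lemma closeA (hn : 7 ≤ n) {s : ℕ} (h : s + 1 = n) : (genPetersen n 3).Adj (A n s) (A n 0) := by
  have := adjA hn (s := s) (t := n) h.symm
  simpa [A] using this

lemma fam1 (m : ℕ) (h : n = 3 * m + 7) : ∃ C, IsHamCycle (genPetersen n 3) C := by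
  have hn : 7 ≤ n := by omega
  obtain ⟨d1, l1, s1⟩ := down hn 4 m (3 * m + 4) (by omega)
  obtain ⟨d2, l2, s2⟩ := up hn 3 (m + 1) (3 * m + 6) (by omega)
  obtain ⟨d3, l3, s3⟩ := down hn 5 m (3 * m + 5) (by omega)
  obtain ⟨d4, l4, s4⟩ := outer hn 5 (3 * m + 1) (3 * m + 6) (by omega)
  refine finish hn
    (.cons (adjAB (t := 0)) <| .cons (adjB hn (by omega)).symm <| d1.append <|
      .cons adjAB.symm <| .cons (adjA hn (s := 3) rfl).symm <| .cons adjAB <| d2.append <|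
      .cons (adjB hn (t := 2) (by omega)) <| .cons adjAB.symm <|
      .cons (adjA hn (s := 1) rfl).symm <| .cons adjAB <|
      .cons (adjB hn (by omega)).symm <| d3.append <| .cons adjAB.symm d4)
    (closeA hn (by omega)) ?_ ?_ ?_
  · simp only [Walk.length_cons, Walk.length_append]; omega
  · intro t ht
    simp only [Walk.support_cons, Walk.mem_support_append_iff, List.mem_cons]
    rcases (by omega : t = 0 ∨ t = 1 ∨ t = 2 ∨ t = 3 ∨ t = 4 ∨ 5 ≤ t) with
      rfl | rfl | rfl | rfl | rfl | h5
    iterate 5 simp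
    simp [s4 t h5 (by omega)]
  · intro t ht
    simp only [Walk.support_cons, Walk.mem_support_append_iff, List.mem_cons]
    rcases (by omega : t = 0 ∨ t = 1 ∨ t = 2 ∨ (3 ≤ t ∧ t % 3 = 0) ∨ (4 ≤ t ∧ t % 3 = 1)
      ∨ (5 ≤ t ∧ t % 3 = 2)) with rfl | rfl | rfl | h5 | h5 | h5
    iterate 3 simp
    · simp [s2 t h5.1 (by omega) h5.2]
    · simp [s1 t h5.1 (by omega) h5.2]
    · simp [s3 t h5.1 (by omega) h5.2]

lemma fam0 (m : ℕ) (h : n = 3 * m + 9) : ∃ C, IsHamCycle (genPetersen n 3) C := by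
  have hn : 7 ≤ n := by omega
  obtain ⟨d1, l1, s1⟩ := down hn 3 (m + 1) (3 * m + 6) (by omega)
  obtain ⟨d2, l2, s2⟩ := up hn 4 (m + 1) (3 * m + 7) (by omega)
  obtain ⟨d3, l3, s3⟩ := down hn 5 (m + 1) (3 * m + 8) (by omega)
  obtain ⟨d4, l4, s4⟩ := outer hn 5 (3 * m + 3) (3 * m + 8) (by omega)
  refine finish hn
    (.cons (adjAB (t := 0)) <| .cons (adjB hn (by omega)).symm <| d1.append <|
      .cons adjAB.symm <| .cons (adjA hn (t := 4) rfl) <| .cons adjAB <| d2.append <|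
      .cons (adjB hn (t := 1) (by omega)) <| .cons adjAB.symm <|
      .cons (adjA hn (t := 2) rfl) <| .cons adjAB <|
      .cons (adjB hn (by omega)).symm <| d3.append <| .cons adjAB.symm d4)
    (closeA hn (by omega)) ?_ ?_ ?_
  · simp only [Walk.length_cons, Walk.length_append]; omega
  · intro t ht
    simp only [Walk.support_cons, Walk.mem_support_append_iff, List.mem_cons]
    rcases (by omega : t = 0 ∨ t = 1 ∨ t = 2 ∨ t = 3 ∨ t = 4 ∨ 5 ≤ t) with
      rfl | rfl | rfl | rfl | rfl | h5
    iterate 5 simp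
    simp [s4 t h5 (by omega)]
  · intro t ht
    simp only [Walk.support_cons, Walk.mem_support_append_iff, List.mem_cons]
    rcases (by omega : t = 0 ∨ t = 1 ∨ t = 2 ∨ (3 ≤ t ∧ t % 3 = 0) ∨ (4 ≤ t ∧ t % 3 = 1)
      ∨ (5 ≤ t ∧ t % 3 = 2)) with rfl | rfl | rfl | h5 | h5 | h5
    iterate 3 simp
    · simp [s1 t h5.1 (by omega) h5.2]
    · simp [s2 t h5.1 (by omega) h5.2]
    · simp [s3 t h5.1 (by omega) h5.2]

lemma fam2 (m : ℕ) (h : n = 3 * m + 11) : ∃ C, IsHamCycle (genPetersen n 3) C := by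
  have hn : 7 ≤ n := by omega
  obtain ⟨d1, l1, s1⟩ := down hn 5 (m + 1) (3 * m + 8) (by omega)
  obtain ⟨d2, l2, s2⟩ := up hn 9 m (3 * m + 9) (by omega)
  obtain ⟨d3, l3, s3⟩ := down hn 10 m (3 * m + 10) (by omega)
  obtain ⟨d4, l4, s4⟩ := outer hn 10 (3 * m) (3 * m + 10) (by omega)
  refine finish hn
    (.cons (adjAB (t := 0)) <| .cons (adjB hn (by omega)).symm <| d1.append <|
      .cons adjAB.symm <| .cons (adjA hn (t := 6) rfl) <| .cons adjAB <|
      .cons (adjB hn (s := 3) (by omega)).symm <| .cons adjAB.symm <|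
      .cons (adjA hn (t := 4) rfl) <| .cons adjAB <|
      .cons (adjB hn (t := 7) (by omega)) <| .cons adjAB.symm <|
      .cons (adjA hn (t := 8) rfl) <| .cons (adjA hn (t := 9) rfl) <| .cons adjAB <| d2.append <|
      .cons (adjB hn (t := 1) (by omega)) <| .cons adjAB.symm <|
      .cons (adjA hn (t := 2) rfl) <| .cons adjAB <|
      .cons (adjB hn (by omega)).symm <| d3.append <| .cons adjAB.symm d4)
    (closeA hn (by omega)) ?_ ?_ ?_
  · simp only [Walk.length_cons, Walk.length_append]; omega
  · intro t ht
    simp only [Walk.support_cons, Walk.mem_support_append_iff, List.mem_cons]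
    by_cases h5 : 10 ≤ t
    · simp [s4 t h5 (by omega)]
    · interval_cases t <;> simp
  · intro t ht
    simp only [Walk.support_cons, Walk.mem_support_append_iff, List.mem_cons]
    rcases (by omega : t = 0 ∨ t = 1 ∨ t = 2 ∨ t = 3 ∨ t = 4 ∨ t = 6 ∨ t = 7 ∨
      (9 ≤ t ∧ t % 3 = 0) ∨ (10 ≤ t ∧ t % 3 = 1)
      ∨ (5 ≤ t ∧ t % 3 = 2)) with rfl | rfl | rfl | rfl | rfl | rfl | rfl | h5 | h5 | h5
    iterate 7 simp
    · simp [s2 t h5.1 (by omega) h5.2]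
    · simp [s3 t h5.1 (by omega) h5.2]
    · simp [s1 t h5.1 (by omega) h5.2]

lemma fam8 (h : n = 8) : ∃ C, IsHamCycle (genPetersen n 3) C := by
  have hn : 7 ≤ n := by omega
  refine finish hn (u := B n 0) (v := B n 3)
    (.cons adjAB.symm <| .cons (adjA hn (t := 1) rfl) <| .cons adjAB <|
      .cons (adjB hn (s := 6) (by omega)).symm <| .cons adjAB.symm <|
      .cons (adjA hn (t := 7) rfl) <| .cons adjAB <|
      .cons (adjB hn (s := 4) (by omega)).symm <| .cons adjAB.symm <|
      .cons (adjA hn (t := 5) rfl) <| .cons adjAB <|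
      .cons (adjB hn (s := 2) (by omega)).symm <| .cons adjAB.symm <|
      .cons (adjA hn (t := 3) rfl) <| .cons adjAB <| .nil)
    (adjB hn (by omega)).symm ?_ ?_ ?_
  · simp only [Walk.length_cons, Walk.length_nil]; omega
  · intro t ht
    simp only [Walk.support_cons, Walk.support_nil, List.mem_cons]
    subst h
    interval_cases t <;> simp
  · intro t ht
    simp only [Walk.support_cons, Walk.support_nil, List.mem_cons]
    subst h
    interval_cases t <;> simp

end GP3

/-- `G(n,3)` is hamiltonian for all `n ≥ 7`. -/
theorem genPetersen_three_hamiltonian (n : ℕ) (hn : 7 ≤ n) :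
    ∃ C, IsHamCycle (genPetersen n 3) C := by
  rcases (by omega : n = 8 ∨ n = 3 * ((n - 9) / 3) + 9 ∨ n = 3 * ((n - 7) / 3) + 7 ∨
    n = 3 * ((n - 11) / 3) + 11) with h | h | h | h
  · exact GP3.fam8 h
  · exact GP3.fam0 _ h
  · exact GP3.fam1 _ h
  · exact GP3.fam2 _ h
end

section
/- For every n ≥ 5 with n ≢ 5 (mod 6), the generalized Petersen graph G(n,2) is hamiltonian, i.e., it contains a connected 2-regular spanning subgraph. -/
/-- spanning subgraph selected by three predicates. -/
def pSub (n : ℕ) (A R B : ZMod n → Prop) : SimpleGraph (ZMod n ⊕ ZMod n) :=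
  SimpleGraph.fromRel fun v w =>
    match v, w with
    | Sum.inl i, Sum.inl j => j = i + 1 ∧ A i
    | Sum.inl i, Sum.inr j => j = i ∧ R i
    | Sum.inr i, Sum.inr j => j = i + ((2 : ℕ) : ZMod n) ∧ B i
    | _, _ => False

def ExTwo (p q r : Prop) : Prop := (p ∧ q ∧ ¬ r) ∨ (p ∧ ¬ q ∧ r) ∨ (¬ p ∧ q ∧ r)

lemma zmod_ne (n c : ℕ) (hc : c < n) (h0 : 0 < c) : (c : ZMod n) ≠ 0 := by
  intro h
  rw [ZMod.natCast_eq_zero_iff] at h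
  exact absurd (Nat.le_of_dvd h0 h) (by omega)

lemma card_two {V : Type*} (P : V → Prop) (x y : V) (hxy : x ≠ y)
    (h : ∀ w, P w ↔ w = x ∨ w = y) : Nat.card {w // P w} = 2 := by
  have h2 : ({w | P w} : Set V) = {x, y} := by
    ext w; simp [h]
  have := Set.ncard_pair hxy
  rw [← h2] at this
  exact this

lemma pSub_deg_a (n : ℕ) (hn : 5 ≤ n) (A R B : ZMod n → Prop) (i : ZMod n)
    (h : ExTwo (A i) (A (i - 1)) (R i)) :
    Nat.card {w // (pSub n A R B).Adj (Sum.inl i) w} = 2 := by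
  have h1 : (1 : ZMod n) ≠ 0 := by simpa using zmod_ne n 1 (by omega) (by omega)
  have h2 : (2 : ZMod n) ≠ 0 := by simpa using zmod_ne n 2 (by omega) (by omega)
  rcases h with ⟨p, q, r⟩ | ⟨p, q, r⟩ | ⟨p, q, r⟩
  · apply card_two _ (Sum.inl (i + 1)) (Sum.inl (i - 1))
    · intro h; rw [Sum.inl.injEq] at h; apply h2; linear_combination h
    · rintro (w | w) <;> simp only [pSub, SimpleGraph.fromRel_adj] <;> grind
  · apply card_two _ (Sum.inl (i + 1)) (Sum.inr i)
    · simp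
    · rintro (w | w) <;> simp only [pSub, SimpleGraph.fromRel_adj] <;> grind
  · apply card_two _ (Sum.inl (i - 1)) (Sum.inr i)
    · simp
    · rintro (w | w) <;> simp only [pSub, SimpleGraph.fromRel_adj] <;> grind

lemma pSub_deg_b (n : ℕ) (hn : 5 ≤ n) (A R B : ZMod n → Prop) (i : ZMod n)
    (h : ExTwo (B i) (B (i - 2)) (R i)) :
    Nat.card {w // (pSub n A R B).Adj (Sum.inr i) w} = 2 := by
  have h1 : (2 : ZMod n) ≠ 0 := by simpa using zmod_ne n 2 (by omega) (by omega)
  have h2 : (4 : ZMod n) ≠ 0 := by simpa using zmod_ne n 4 (by omega) (by omega)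
  rcases h with ⟨p, q, r⟩ | ⟨p, q, r⟩ | ⟨p, q, r⟩
  · apply card_two _ (Sum.inr (i + 2)) (Sum.inr (i - 2))
    · intro h; rw [Sum.inr.injEq] at h; apply h2; linear_combination h
    · rintro (w | w) <;> simp only [pSub, SimpleGraph.fromRel_adj, Nat.cast_ofNat] <;> grind
  · apply card_two _ (Sum.inr (i + 2)) (Sum.inl i)
    · simp
    · rintro (w | w) <;> simp only [pSub, SimpleGraph.fromRel_adj, Nat.cast_ofNat] <;> grind
  · apply card_two _ (Sum.inr (i - 2)) (Sum.inl i)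
    · simp
    · rintro (w | w) <;> simp only [pSub, SimpleGraph.fromRel_adj, Nat.cast_ofNat] <;> grind

lemma pSub_le (n : ℕ) (A R B : ZMod n → Prop) : pSub n A R B ≤ genPetersen n 2 := by
  rintro (v | v) (w | w) <;>
    simp only [pSub, genPetersen, SimpleGraph.fromRel_adj] <;> tauto

lemma ham_of (n : ℕ) (hn : 5 ≤ n) (A R B : ℕ → Prop)
    (hA : ∀ i < n, ExTwo (A ((i + 1) % n)) (A i) (R ((i + 1) % n)))
    (hB : ∀ i < n, ExTwo (B ((i + 2) % n)) (B i) (R ((i + 2) % n)))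
    (hc : ∀ PA PB : ℕ → Prop, (∀ i, PA (i + n) ↔ PA i) → (∀ i, PB (i + n) ↔ PB i) →
      (∀ i, A (i % n) → (PA i ↔ PA (i + 1))) → (∀ i, R (i % n) → (PA i ↔ PB i)) →
      (∀ i, B (i % n) → (PB i ↔ PB (i + 2))) → PA 0 → ∀ i < n, PA i ∧ PB i) :
    ∃ C, IsHamCycle (genPetersen n 2) C := by
  have : NeZero n := ⟨by omega⟩
  have h1 : (1 : ZMod n) ≠ 0 := by simpa using zmod_ne n 1 (by omega) (by omega)
  have h2 : (2 : ZMod n) ≠ 0 := by simpa using zmod_ne n 2 (by omega) (by omega)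
  let C := pSub n (fun i => A i.val) (fun i => R i.val) (fun i => B i.val)
  refine ⟨C, pSub_le _ _ _ _, ?_, ?_⟩
  · have key := hc (fun i => C.Reachable (Sum.inl 0) (Sum.inl (i : ZMod n)))
      (fun i => C.Reachable (Sum.inl 0) (Sum.inr (i : ZMod n)))
      (by simp) (by simp) ?_ ?_ ?_ (by simp)
    · have hall : ∀ v, C.Reachable (Sum.inl 0) v := by
        rintro (v | v)
        · have := (key v.val v.val_lt).1
          simpa using this
        · have := (key v.val v.val_lt).2
          simpa using this
      exact ⟨fun u v => (hall u).symm.trans (hall v)⟩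
    · intro i hi
      have : C.Adj (Sum.inl (i : ZMod n)) (Sum.inl ((i + 1 : ℕ) : ZMod n)) := by
        simp only [C, pSub, SimpleGraph.fromRel_adj, ZMod.val_natCast]
        refine ⟨?_, Or.inl ⟨by push_cast; rfl, hi⟩⟩
        simpa using h1
      exact ⟨fun h => h.trans this.reachable, fun h => h.trans this.symm.reachable⟩
    · intro i hi
      have : C.Adj (Sum.inl (i : ZMod n)) (Sum.inr (i : ZMod n)) := by
        simp only [C, pSub, SimpleGraph.fromRel_adj, ZMod.val_natCast]
        exact ⟨by simp, Or.inl ⟨by trivial, hi⟩⟩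
      exact ⟨fun h => h.trans this.reachable, fun h => h.trans this.symm.reachable⟩
    · intro i hi
      have : C.Adj (Sum.inr (i : ZMod n)) (Sum.inr ((i + 2 : ℕ) : ZMod n)) := by
        simp only [C, pSub, SimpleGraph.fromRel_adj, ZMod.val_natCast]
        refine ⟨?_, Or.inl ⟨by push_cast; rfl, hi⟩⟩
        simpa using h2
      exact ⟨fun h => h.trans this.reachable, fun h => h.trans this.symm.reachable⟩
  · rintro (v | v)
    · apply pSub_deg_a n hn
      have h := hA (v - 1).val (v - 1).val_lt
      have e : ((v - 1).val + 1) % n = v.val := by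
        rw [← ZMod.val_natCast]; simp
      rwa [e] at h
    · apply pSub_deg_b n hn
      have h := hB (v - 2).val (v - 2).val_lt
      have e : ((v - 2).val + 2) % n = v.val := by
        rw [← ZMod.val_natCast]; simp
      rwa [e] at h

lemma ham_even (m : ℕ) (hm : 2 ≤ m) (he : m % 2 = 0) :
    ∃ C, IsHamCycle (genPetersen (m + 4) 2) C := by
  apply ham_of (m + 4) (by omega) (fun i => i ≠ m ∧ i ≠ m + 2) (fun i => m ≤ i)
    (fun i => i ≠ m ∧ i ≠ m + 1)
  · intro i hi
    unfold ExTwo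
    rcases (by omega : i + 1 < m + 4 ∨ i + 1 = m + 4) with h | h
    · rw [Nat.mod_eq_of_lt h]; omega
    · rw [h, Nat.mod_self]; omega
  · intro i hi
    unfold ExTwo
    rcases (by omega : i + 2 < m + 4 ∨ i + 2 = m + 4 ∨ i + 2 = (m + 4) + 1) with h | h | h
    · rw [Nat.mod_eq_of_lt h]; omega
    · rw [h, Nat.mod_self]; omega
    · rw [h, Nat.add_mod_left, Nat.mod_eq_of_lt (by omega)]; omega
  · intro PA PB pA pB hA hR hB h0
    have hA' : ∀ i < m + 4, i ≠ m ∧ i ≠ m + 2 → (PA i ↔ PA (i + 1)) := fun i hi h =>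
      hA i (by rwa [Nat.mod_eq_of_lt hi])
    have hR' : ∀ i < m + 4, m ≤ i → (PA i ↔ PB i) := fun i hi h =>
      hR i (by rwa [Nat.mod_eq_of_lt hi])
    have hB' : ∀ i < m + 4, i ≠ m ∧ i ≠ m + 1 → (PB i ↔ PB (i + 2)) := fun i hi h =>
      hB i (by rwa [Nat.mod_eq_of_lt hi])
    have a1 : ∀ i, i ≤ m → PA i := by
      intro i
      induction i with
      | zero => intro _; exact h0
      | succ k ih => intro hk; exact (hA' k (by omega) (by omega)).1 (ih (by omega))
    have b1 : ∀ t, 2 * t ≤ m → (PB 0 ↔ PB (2 * t)) := by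
      intro t
      induction t with
      | zero => intro _; rfl
      | succ k ih => intro hk; exact (ih (by omega)).trans (hB' (2 * k) (by omega) (by omega))
    have b2 : ∀ t, 2 * t ≤ m → (PB 1 ↔ PB (2 * t + 1)) := by
      intro t
      induction t with
      | zero => intro _; rfl
      | succ k ih => intro hk; exact (ih (by omega)).trans (hB' (2 * k + 1) (by omega) (by omega))
    have e1 : PB m := (hR' m (by omega) le_rfl).1 (a1 m le_rfl)
    obtain ⟨s, rfl⟩ : ∃ s, m = 2 * s := ⟨m / 2, by omega⟩
    have e2 : PB 0 := (b1 s le_rfl).2 e1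
    have e3 : PB (2 * s + 2) := (hB' _ (by omega) (by omega)).2 ((by simpa using pB 0 : PB (2 * s + 4) ↔ PB 0).2 e2)
    have e4 : PA (2 * s + 2) := (hR' _ (by omega) (by omega)).2 e3
    have e5 : PA (2 * s + 1) := (hA' _ (by omega) (by omega)).2 e4
    have e6 : PB (2 * s + 1) := (hR' _ (by omega) (by omega)).1 e5
    have e7 : PB 1 := (b2 s le_rfl).2 e6
    have e8 : PB (2 * s + 3) := by
      refine (hB' _ (by omega) (by omega)).2 ?_
      have := (pB 1).2 e7
      rwa [show 1 + (2 * s + 4) = 2 * s + 3 + 2 by ring] at this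
    have e9 : PA (2 * s + 3) := (hR' _ (by omega) (by omega)).2 e8
    intro i hi
    rcases (by omega : i ≤ 2 * s ∨ i = 2 * s + 1 ∨ i = 2 * s + 2 ∨ i = 2 * s + 3) with h | rfl | rfl | rfl
    · refine ⟨a1 i h, ?_⟩
      rcases (by omega : i = 2 * (i / 2) ∨ i = 2 * (i / 2) + 1) with h' | h' <;> rw [h']
      · exact (b1 _ (by omega)).1 e2
      · exact (b2 _ (by omega)).1 e7
    · exact ⟨e5, e6⟩
    · exact ⟨e4, e3⟩
    · exact ⟨e9, e8⟩

lemma ham_three (k : ℕ) (hk : 1 ≤ k) :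
    ∃ C, IsHamCycle (genPetersen (6 * k + 3) 2) C := by
  apply ham_of (6 * k + 3) (by omega) (fun i => i % 3 ≠ 2) (fun i => i % 3 ≠ 1)
    (fun i => i % 3 ≠ 0)
  · intro i hi
    unfold ExTwo
    rw [Nat.mod_mod_of_dvd _ (by omega)]
    omega
  · intro i hi
    unfold ExTwo
    rw [Nat.mod_mod_of_dvd _ (by omega)]
    omega
  · intro PA PB pA pB hA hR hB h0
    have hm : ∀ i, i % (6 * k + 3) % 3 = i % 3 := fun i => Nat.mod_mod_of_dvd _ (by omega)
    simp only [hm] at hA hR hB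
    have stp : ∀ t, PA (3 * t) → PA (3 * t + 1) ∧ PA (3 * t + 2) ∧ PB (3 * t + 2) ∧
        PB (3 * t + 4) ∧ PA (3 * t + 6) := by
      intro t h
      have c1 := (hA _ (by omega)).1 h
      have c2 := (hA _ (by omega)).1 c1
      have c3 := (hR _ (by omega)).1 c2
      have c4 := (hB _ (by omega)).1 c3
      have c5 := (hB _ (by omega)).1 c4
      exact ⟨c1, c2, c3, c4, (hR _ (by omega)).2 c5⟩
    have e6 : ∀ t, PA (6 * t) := by
      intro t
      induction t with
      | zero => exact h0
      | succ t ih =>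
        have := (stp (2 * t) (by rwa [show 3 * (2 * t) = 6 * t by ring])).2.2.2.2
        rwa [show 3 * (2 * t) + 6 = 6 * (t + 1) by ring] at this
    have e3 : ∀ t, PA (3 * t) := by
      intro t
      rcases (by omega : t = 2 * (t / 2) ∨ t = 2 * (t / 2) + 1) with h | h
      · have := e6 (t / 2)
        rwa [show 6 * (t / 2) = 3 * t by omega] at this
      · refine (pA _).1 ?_
        have := e6 (t / 2 + k + 1)
        rwa [show 6 * (t / 2 + k + 1) = 3 * t + (6 * k + 3) by omega] at this
    intro i hi
    rcases (by omega : i = 3 * (i / 3) ∨ i = 3 * (i / 3) + 1 ∨ i = 3 * (i / 3) + 2) with h | h | h <;>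
      rw [h] <;> generalize i / 3 = t
    · exact ⟨e3 t, (hR _ (by omega)).1 (e3 t)⟩
    · refine ⟨(stp t (e3 t)).1, (pB _).1 ?_⟩
      have := (stp (t + 2 * k) (e3 _)).2.2.2.1
      rwa [show 3 * (t + 2 * k) + 4 = 3 * t + 1 + (6 * k + 3) by ring] at this
    · exact ⟨(stp t (e3 t)).2.1, (stp t (e3 t)).2.2.1⟩

lemma ham_one (j : ℕ) (hj : j % 2 = 1) :
    ∃ C, IsHamCycle (genPetersen (3 * j + 4) 2) C := by
  apply ham_of (3 * j + 4) (by omega)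
    (fun i => (i < 3 * j ∧ i % 3 ≠ 2) ∨ i = 3 * j ∨ i = 3 * j + 2)
    (fun i => (i < 3 * j ∧ i % 3 ≠ 1) ∨ 3 * j ≤ i)
    (fun i => (i < 3 * j ∧ i % 3 ≠ 0) ∨ 3 * j + 2 ≤ i)
  · intro i hi
    unfold ExTwo
    rcases (by omega : i + 1 < 3 * j + 4 ∨ i + 1 = 3 * j + 4) with h | h
    · rw [Nat.mod_eq_of_lt h]; omega
    · rw [h, Nat.mod_self]; omega
  · intro i hi
    unfold ExTwo
    rcases (by omega : i + 2 < 3 * j + 4 ∨ i + 2 = 3 * j + 4 ∨ i + 2 = (3 * j + 4) + 1) with h | h | h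
    · rw [Nat.mod_eq_of_lt h]; omega
    · rw [h, Nat.mod_self]; omega
    · rw [h, Nat.add_mod_left, Nat.mod_eq_of_lt (by omega)]; omega
  · intro PA PB pA pB hA hR hB h0
    have hA' : ∀ i < 3 * j + 4, ((i < 3 * j ∧ i % 3 ≠ 2) ∨ i = 3 * j ∨ i = 3 * j + 2) →
        (PA i ↔ PA (i + 1)) := fun i hi h => hA i (by rwa [Nat.mod_eq_of_lt hi])
    have hR' : ∀ i < 3 * j + 4, ((i < 3 * j ∧ i % 3 ≠ 1) ∨ 3 * j ≤ i) → (PA i ↔ PB i) :=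
      fun i hi h => hR i (by rwa [Nat.mod_eq_of_lt hi])
    have hB' : ∀ i < 3 * j + 4, ((i < 3 * j ∧ i % 3 ≠ 0) ∨ 3 * j + 2 ≤ i) →
        (PB i ↔ PB (i + 2)) := fun i hi h => hB i (by rwa [Nat.mod_eq_of_lt hi])
    have f1 : PB 0 := (hR' 0 (by omega) (by omega)).1 h0
    have f2 : PB (3 * j + 2) := (hB' _ (by omega) (by omega)).2
      ((by simpa using pB 0 : PB (3 * j + 4) ↔ PB 0).2 f1)
    have f3 : PA (3 * j + 2) := (hR' _ (by omega) (by omega)).2 f2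
    have f4 : PA (3 * j + 3) := (hA' _ (by omega) (by omega)).1 f3
    have f5 : PB (3 * j + 3) := (hR' _ (by omega) (by omega)).1 f4
    have f6 : PB 1 := by
      refine (pB 1).1 ?_
      have := (hB' _ (by omega) (by omega)).1 f5
      rwa [show 3 * j + 3 + 2 = 1 + (3 * j + 4) by ring] at this
    have f7 : PB 3 := (hB' 1 (by omega) (by omega)).1 f6
    have f8 : PA 3 := (hR' 3 (by omega) (by omega)).2 f7
    have stp : ∀ t < j, PA (3 * t) → PA (3 * t + 1) ∧ PA (3 * t + 2) ∧ PB (3 * t + 2) ∧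
        PB (3 * t + 4) := by
      intro t ht h
      have c1 := (hA' _ (by omega) (by omega)).1 h
      have c2 := (hA' _ (by omega) (by omega)).1 c1
      have c3 := (hR' _ (by omega) (by omega)).1 c2
      have c4 := (hB' _ (by omega) (by omega)).1 c3
      exact ⟨c1, c2, c3, c4⟩
    have all : ∀ t, (t ≤ j → PA (3 * t)) ∧ (t + 1 ≤ j → PA (3 * (t + 1))) := by
      intro t
      induction t with
      | zero => exact ⟨fun _ => h0, fun _ => f8⟩
      | succ t ih =>
        refine ⟨ih.2, fun h => ?_⟩
        have c4 := (stp t (by omega) (ih.1 (by omega))).2.2.2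
        have c5 := (hB' _ (by omega) (by omega)).1 c4
        exact (hR' _ (by omega) (by omega)).2 c5
    have g1 : PA (3 * j) := (all j).1 le_rfl
    have g2 : PA (3 * j + 1) := (hA' _ (by omega) (by omega)).1 g1
    intro i hi
    rcases (by omega : i < 3 * j ∨ i = 3 * j ∨ i = 3 * j + 1 ∨ i = 3 * j + 2 ∨ i = 3 * j + 3)
      with h' | rfl | rfl | rfl | rfl
    · rcases (by omega : i = 3 * (i / 3) ∨ i = 3 * (i / 3) + 1 ∨ i = 3 * (i / 3) + 2)
        with h | h | h <;> (rw [h] at h' ⊢; generalize i / 3 = t at h' ⊢)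
      · have := (all t).1 (by omega)
        exact ⟨this, (hR' _ (by omega) (by omega)).1 this⟩
      · refine ⟨(stp t (by omega) ((all t).1 (by omega))).1, ?_⟩
        rcases t with _ | t
        · exact f6
        · exact (stp t (by omega) ((all t).1 (by omega))).2.2.2
      · have := stp t (by omega) ((all t).1 (by omega))
        exact ⟨this.2.1, this.2.2.1⟩
    · exact ⟨g1, (hR' _ (by omega) (by omega)).1 g1⟩
    · exact ⟨g2, (hR' _ (by omega) (by omega)).1 g2⟩
    · exact ⟨f3, f2⟩
    · exact ⟨f4, f5⟩

/-- `G(n,2)` is hamiltonian whenever `n ≥ 5` and `n ≢ 5 (mod 6)`. -/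
theorem genPetersen_two_hamiltonian (n : ℕ) (hn : 5 ≤ n) (h : n % 6 ≠ 5) :
    ∃ C, IsHamCycle (genPetersen n 2) C := by
  rcases (by omega : n % 2 = 0 ∨ n % 6 = 3 ∨ n % 6 = 1) with h' | h' | h'
  · obtain ⟨m, rfl⟩ : ∃ m, n = m + 4 := ⟨n - 4, by omega⟩
    exact ham_even m (by omega) (by omega)
  · obtain ⟨k, rfl⟩ : ∃ k, n = 6 * k + 3 := ⟨n / 6, by omega⟩
    exact ham_three k (by omega)
  · obtain ⟨j, rfl⟩ : ∃ j, n = 3 * j + 4 := ⟨(n - 4) / 3, by omega⟩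
    exact ham_one j (by omega)
end
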